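/- arXiv:2203.10450 — 3 statements merged into one kernel-verified Lean document; each statement's English description precedes it below -/
import Mathlib

section
/- Let P ⊆ {x ∈ ℝ^N : x_N ≥ 0} be a polyhedron with positive N-dimensional Lebesgue measure such that M := P ∩ {x ∈ ℝ^N : x_N = 0} is nonempty and bounded, and let d be the affine dimension of M (so 0 ≤ d ≤ N−1). Then there exist δ > 0 and constants v_{i,k} > 0 for i = 1,2 and k = N−1−d, …, N−1 such that, setting p_i(t) = Σ_{k=N−1−d}^{N−1} v_{i,k} t^k, one has p₂(t) ≤ S_P(t) ≤ p₁(t) for all 0 ≤ t ≤ δ. -/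
open MeasureTheory

theorem exists_nonneg_combination_of_forall_le {V : Type*} [AddCommGroup V] [Module ℝ V] {m : ℕ}
    (a : Fin m → V →ₗ[ℝ] ℝ) (b : V →ₗ[ℝ] ℝ) (H : ∀ x, (∀ i, a i x ≤ 0) → b x ≤ 0) :
    ∃ c : Fin m → ℝ, (∀ i, 0 ≤ c i) ∧ ∀ x, b x = ∑ i, c i * a i x := by
  induction m generalizing b with
  | zero =>
    refine ⟨fun _ => 0, fun _ => le_rfl, fun x => ?_⟩
    have h₁ := H x (fun i => i.elim0)
    have h₂ := H (-x) (fun i => i.elim0)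
    rw [map_neg] at h₂
    simp only [Finset.univ_eq_empty, Finset.sum_empty]
    linarith
  | succ m ih =>
    by_cases hb : ∀ x, (∀ i : Fin m, a i.succ x ≤ 0) → b x ≤ 0
    · obtain ⟨c, hc, hbc⟩ := ih (fun i => a i.succ) b hb
      refine ⟨Fin.cons 0 c, Fin.forall_fin_succ.2 ⟨by simp, by simpa using hc⟩, fun x => ?_⟩
      simp [Fin.sum_univ_succ, hbc x]
    · push Not at hb
      obtain ⟨x₀, hx₀, hbx₀⟩ := hb
      have hpos : 0 < a 0 x₀ := by
        by_contra! h
        exact absurd (H x₀ (Fin.cases h hx₀)) (not_le.2 hbx₀)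
      set x : V := (a 0 x₀)⁻¹ • x₀ with hx
      have ha0 : a 0 x = 1 := by simp [hx, hpos.ne']
      have hax : ∀ i : Fin m, a i.succ x ≤ 0 := fun i => by
        simpa [hx] using mul_nonpos_of_nonneg_of_nonpos (inv_nonneg.2 hpos.le) (hx₀ i)
      have hbx : 0 ≤ b x := by
        simpa [hx] using mul_nonneg (inv_nonneg.2 hpos.le) hbx₀.le
      obtain ⟨c, hc, hbc⟩ := ih (fun i => a i.succ - a i.succ x • a 0) (b - b x • a 0) (by
        intro y hy
        have := H (y - a 0 y • x) (Fin.forall_fin_succ.2 ⟨by simp [ha0], fun i => by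
          have := hy i
          simp only [LinearMap.sub_apply, LinearMap.smul_apply, smul_eq_mul, map_sub,
            map_smul] at this ⊢
          linarith⟩)
        simp only [LinearMap.sub_apply, LinearMap.smul_apply, smul_eq_mul, map_sub,
            map_smul] at this ⊢
        linarith)
      refine ⟨Fin.cons (b x - ∑ i, c i * a i.succ x) c,
        Fin.forall_fin_succ.2 ⟨?_, by simpa using hc⟩, fun y => ?_⟩
      · have : ∑ i, c i * a i.succ x ≤ 0 :=
          Finset.sum_nonpos fun i _ => mul_nonpos_of_nonneg_of_nonpos (hc i) (hax i)
        simp only [Fin.cons_zero]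
        linarith
      · have := hbc y
        simp only [LinearMap.sub_apply, LinearMap.smul_apply, smul_eq_mul, mul_sub,
          Finset.sum_sub_distrib, ← mul_assoc, ← Finset.sum_mul] at this
        simp only [Fin.sum_univ_succ, Fin.cons_zero, Fin.cons_succ]
        linarith

theorem exists_le_add_mul_of_polyhedron {V : Type*} [AddCommGroup V] [Module ℝ V] {m : ℕ}
    (g : Fin m → V →ᵃ[ℝ] ℝ) (h f : V →ₗ[ℝ] ℝ) (r : ℝ)
    (hh : ∀ x, (∀ i, g i x ≤ 0) → 0 ≤ h x) (hne : ∃ x, (∀ i, g i x ≤ 0) ∧ h x = 0)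
    (hf : ∀ x, (∀ i, g i x ≤ 0) → h x = 0 → f x ≤ r) :
    ∃ μ : ℝ, 0 ≤ μ ∧ ∀ x, (∀ i, g i x ≤ 0) → f x ≤ r + μ * h x := by
  have hg : ∀ i x, g i x = (g i).linear x + g i 0 := fun i x =>
    congrFun (AffineMap.decomp (g i)) x
  obtain ⟨x₀, hx₀, hhx₀⟩ := hne
  let G : Fin m → V × ℝ →ₗ[ℝ] ℝ := fun i =>
    (g i).linear.comp (LinearMap.fst ℝ V ℝ) + g i 0 • LinearMap.snd ℝ V ℝ
  have hG : ∀ i x s, G i (x, s) = (g i).linear x + g i 0 * s := fun i x s => by simp [G]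
  obtain ⟨c, hc, hfc⟩ := exists_nonneg_combination_of_forall_le
    (Fin.cons (-LinearMap.snd ℝ V ℝ) (Fin.cons (h.comp (LinearMap.fst ℝ V ℝ)) G) :
      Fin (m + 2) → V × ℝ →ₗ[ℝ] ℝ)
    (f.comp (LinearMap.fst ℝ V ℝ) - r • LinearMap.snd ℝ V ℝ) (by
      rintro ⟨x, s⟩ H
      simp only [Fin.forall_fin_succ, Fin.cons_zero, Fin.cons_succ, LinearMap.neg_apply,
        LinearMap.snd_apply, LinearMap.comp_apply, LinearMap.fst_apply, hG] at H
      obtain ⟨hs, hhx, hgx⟩ := H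
      simp only [LinearMap.sub_apply, LinearMap.comp_apply, LinearMap.fst_apply,
        LinearMap.smul_apply, LinearMap.snd_apply, smul_eq_mul]
      rcases (neg_nonpos.1 hs).eq_or_lt with rfl | hs
      · simp only [mul_zero, add_zero, sub_zero] at hgx ⊢
        by_contra! hfx
        have hmem : ∀ k : ℝ, 0 ≤ k → ∀ i, g i (x₀ + k • x) ≤ 0 := fun k hk i => by
          have h₁ := hx₀ i
          have h₂ := mul_nonpos_of_nonneg_of_nonpos hk (hgx i)
          rw [hg] at h₁ ⊢
          simp only [map_add, map_smul, smul_eq_mul]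
          linarith
        have hray : ∀ k : ℝ, 0 ≤ k → f x₀ + k * f x ≤ r := fun k hk => by
          have h₁ := hh _ (hmem k hk)
          have h₂ := mul_nonpos_of_nonneg_of_nonpos hk hhx
          have h₃ := hf _ (hmem k hk)
          simp only [map_add, map_smul, smul_eq_mul] at h₁ h₃
          exact h₃ (by linarith)
        have h₀ := hray 0 le_rfl
        have h₁ := hray ((r - f x₀ + 1) / f x) (div_nonneg (by linarith) hfx.le)
        rw [div_mul_cancel₀ _ hfx.ne'] at h₁
        linarith
      · have hmem : ∀ i, g i (s⁻¹ • x) ≤ 0 := fun i => by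
          have := mul_nonpos_of_nonneg_of_nonpos (inv_nonneg.2 hs.le) (hgx i)
          rw [hg, map_smul, smul_eq_mul]
          rwa [mul_add, mul_comm (g i 0), inv_mul_cancel_left₀ hs.ne'] at this
        have h₁ := hh _ hmem
        have h₂ := mul_nonpos_of_nonneg_of_nonpos (inv_nonneg.2 hs.le) hhx
        have h₃ := hf _ hmem
        simp only [map_smul, smul_eq_mul] at h₁ h₃
        have h₄ := mul_le_mul_of_nonneg_left (h₃ (by linarith)) hs.le
        rw [mul_inv_cancel_left₀ hs.ne'] at h₄
        linarith)
  refine ⟨c 1, hc 1, fun x hx => ?_⟩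
  have h₁ := hfc (x, 1)
  have h₂ : ∑ i : Fin m, c i.succ.succ * G i (x, 1) ≤ 0 :=
    Finset.sum_nonpos fun i _ => mul_nonpos_of_nonneg_of_nonpos (hc _) (by
      rw [hG, mul_one, ← hg]; exact hx i)
  simp only [Fin.sum_univ_succ, Fin.cons_zero, Fin.cons_succ, LinearMap.neg_apply,
    LinearMap.snd_apply, LinearMap.comp_apply, LinearMap.fst_apply, LinearMap.sub_apply,
    LinearMap.smul_apply, smul_eq_mul, Fin.succ_zero_eq_one] at h₁
  have := hc 0
  linarith

theorem exists_basis_adapted {n : ℕ} (W : Submodule ℝ (Fin n → ℝ)) :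
    ∃ (b : Module.Basis (Fin n) ℝ (Fin n → ℝ)) (s : Finset (Fin n)),
      s.card = Module.finrank ℝ W ∧ (∀ i ∈ s, b i ∈ W) ∧ ∀ i ∉ s, ∀ w ∈ W, b.repr w i = 0 := by
  classical
  let b₀ := (Module.finBasis ℝ W).sumQuot (Module.finBasis ℝ ((Fin n → ℝ) ⧸ W))
  let e := b₀.indexEquiv (Pi.basisFun ℝ (Fin n))
  refine ⟨b₀.reindex e, Finset.univ.image fun i => e (Sum.inl i), ?_, ?_, ?_⟩
  · rw [Finset.card_image_of_injective (f := fun i => e (Sum.inl i)) _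
      (e.injective.comp Sum.inl_injective), Finset.card_univ,
      Fintype.card_fin]
  · intro i hi
    obtain ⟨j, -, rfl⟩ := Finset.mem_image.1 hi
    simp [b₀]
  · intro i hi w hw
    obtain ⟨j | j, rfl⟩ := e.surjective i
    · exact absurd (Finset.mem_image_of_mem _ (Finset.mem_univ j)) hi
    · simp [b₀, Module.Basis.sumQuot_repr_inr, (Submodule.Quotient.mk_eq_zero W).2 hw]

theorem exists_volume_basis_box {n : ℕ} (b : Module.Basis (Fin n) ℝ (Fin n → ℝ)) :
    ∃ κ : ℝ, 0 < κ ∧ ∀ (p l u : Fin n → ℝ), l ≤ u →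
      volume {x | ∀ i, b.repr (x - p) i ∈ Set.Icc (l i) (u i)} =
        ENNReal.ofReal (κ * ∏ i, (u i - l i)) := by
  refine ⟨|LinearMap.det (b.equivFun.symm : (Fin n → ℝ) →ₗ[ℝ] (Fin n → ℝ))|,
    abs_pos.2 (LinearEquiv.isUnit_det' _).ne_zero, fun p l u hlu => ?_⟩
  have hset : {x | ∀ i, b.repr (x - p) i ∈ Set.Icc (l i) (u i)} =
      (fun x => x + -p) ⁻¹' (b.equivFun ⁻¹' Set.Icc l u) := by
    ext x
    simp [Pi.le_def, forall_and, sub_eq_add_neg]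
  rw [hset, measure_preimage_add_right, Measure.addHaar_preimage_linearEquiv, Real.volume_Icc_pi,
    ← ENNReal.ofReal_prod_of_nonneg fun i _ => sub_nonneg.2 (hlu i),
    ← ENNReal.ofReal_mul (abs_nonneg _)]

theorem snoc_convex_combination {n : ℕ} (a c s t : ℝ) (x y : Fin n → ℝ) :
    (Fin.snoc (a • x + c • y) (a * s + c * t) : Fin (n + 1) → ℝ) =
      a • (Fin.snoc x s : Fin (n + 1) → ℝ) + c • (Fin.snoc y t : Fin (n + 1) → ℝ) := by
  ext i
  refine Fin.lastCases ?_ (fun j => ?_) i <;> simp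

theorem Convex.exists_add_mem_of_mem_vectorSpan {E : Type*} [NormedAddCommGroup E]
    [NormedSpace ℝ E] [FiniteDimensional ℝ E] {K : Set E} (hK : Convex ℝ K) (hne : K.Nonempty) :
    ∃ p, ∃ ε > 0, ∀ w ∈ vectorSpan ℝ K, ‖w‖ < ε → p + w ∈ K := by
  obtain ⟨p, hp⟩ := hne.intrinsicInterior hK
  obtain ⟨y, hy, rfl⟩ := mem_intrinsicInterior.1 hp
  obtain ⟨ε, hε, hball⟩ := Metric.mem_nhds_iff.1 (mem_interior_iff_mem_nhds.1 hy)
  refine ⟨y, ε, hε, fun w hw hwε => ?_⟩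
  have hmem : w +ᵥ (y : E) ∈ affineSpan ℝ K :=
    AffineSubspace.vadd_mem_of_mem_direction (by rwa [direction_affineSpan]) y.2
  have : (⟨w +ᵥ (y : E), hmem⟩ : affineSpan ℝ K) ∈ Metric.ball y ε := by
    simpa [Metric.mem_ball, Subtype.dist_eq, dist_eq_norm] using hwε
  simpa [add_comm] using hball this

theorem Convex.exists_slice_ball_subset {n : ℕ} {P : Set (Fin (n + 1) → ℝ)} (hP : Convex ℝ P)
    (hPsub : ∀ x ∈ P, 0 ≤ x (Fin.last n)) (hvol : 0 < volume P) :
    ∃ (q : Fin n → ℝ) (h : ℝ), 0 < h ∧ ∃ ε > 0, ∀ w : Fin n → ℝ, ‖w‖ < ε →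
      (Fin.snoc (q + w) h : Fin (n + 1) → ℝ) ∈ P := by
  have hint : (interior P).Nonempty := by
    by_contra hemp
    rw [Set.not_nonempty_iff_eq_empty] at hemp
    refine hvol.ne' (measure_mono_null ?_ (hP.addHaar_frontier volume))
    rw [frontier, hemp, Set.sdiff_empty]
    exact subset_closure
  obtain ⟨x, hx⟩ := hint
  obtain ⟨ε, hε, hball⟩ := Metric.mem_nhds_iff.1 (mem_interior_iff_mem_nhds.1 hx)
  have hmem : ∀ (w : Fin n → ℝ) (r : ℝ), ‖w‖ < ε → |r| < ε →
      (Fin.snoc (Fin.init x + w) (x (Fin.last n) + r) : Fin (n + 1) → ℝ) ∈ P := by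
    refine fun w r hw hr => hball ?_
    rw [Metric.mem_ball, dist_pi_lt_iff hε]
    refine Fin.lastCases ?_ fun j => ?_
    · simpa [Real.dist_eq] using hr
    · simpa [Real.dist_eq, Fin.init] using (norm_le_pi_norm w j).trans_lt hw
  refine ⟨Fin.init x, x (Fin.last n), ?_, ε, hε, fun w hw => ?_⟩
  · have := hPsub _ (hmem 0 (-(ε / 2)) (by simpa using hε)
      (by rw [abs_neg, abs_of_pos (half_pos hε)]; exact half_lt_self hε))
    simp only [Fin.snoc_last] at this
    linarith
  · simpa using hmem w 0 hw (by simpa using hε)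

theorem prod_ite_mem_one {n : ℕ} (s : Finset (Fin n)) (c t : ℝ) :
    ∏ i, c * (if i ∈ s then 1 else t) = c ^ n * t ^ (n - s.card) := by
  rw [Finset.prod_mul_distrib, Finset.prod_ite]
  simp [Finset.filter_not, Finset.card_sdiff]

theorem exists_slice_volume_lower {n : ℕ} {P : Set (Fin (n + 1) → ℝ)} (hP : Convex ℝ P)
    (hPsub : ∀ x ∈ P, 0 ≤ x (Fin.last n)) (hvol : 0 < volume P) {K : Set (Fin n → ℝ)}
    (hK : K = {x | (Fin.snoc x 0 : Fin (n + 1) → ℝ) ∈ P}) (hne : K.Nonempty) :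
    ∃ h > 0, ∃ c > 0, ∀ t : ℝ, 0 ≤ t → t ≤ h →
      ENNReal.ofReal (c * t ^ (n - Module.finrank ℝ (vectorSpan ℝ K))) ≤
        volume {x : Fin n → ℝ | (Fin.snoc x t : Fin (n + 1) → ℝ) ∈ P} := by
  have hKconv : Convex ℝ K := by
    subst hK
    intro x hx y hy a c ha hc hac
    have := hP hx hy ha hc hac
    rwa [← snoc_convex_combination, mul_zero, mul_zero, add_zero] at this
  obtain ⟨p, ε₁, hε₁, hp⟩ := hKconv.exists_add_mem_of_mem_vectorSpan hne
  obtain ⟨q, h, hh, ε₂, hε₂, hq⟩ := hP.exists_slice_ball_subset hPsub hvol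
  obtain ⟨b, s, hs, hbs, -⟩ := exists_basis_adapted (vectorSpan ℝ K)
  obtain ⟨κ, hκ, hbox⟩ := exists_volume_basis_box b
  obtain ⟨ε, hε, hball⟩ : ∃ ε > 0, ∀ y : Fin n → ℝ, (∀ i, 0 ≤ y i ∧ y i ≤ ε) →
      ‖b.equivFun.symm y‖ < min ε₁ ε₂ := by
    have hcont : Continuous fun y => ‖b.equivFun.symm y‖ :=
      (LinearMap.continuous_of_finiteDimensional b.equivFun.symm.toLinearMap).norm
    obtain ⟨ε, hε, hball⟩ := Metric.mem_nhds_iff.1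
      ((isOpen_Iio.preimage hcont).mem_nhds
        (show (0 : Fin n → ℝ) ∈ _ by simpa using ⟨hε₁, hε₂⟩ : _ ∈ _ ⁻¹' Set.Iio (min ε₁ ε₂)))
    refine ⟨ε / 2, half_pos hε, fun y hy => hball ?_⟩
    rw [mem_ball_zero_iff]
    refine lt_of_le_of_lt ((pi_norm_le_iff_of_nonneg (half_pos hε).le).2 fun i => ?_)
      (half_lt_self hε)
    rw [Real.norm_eq_abs, abs_of_nonneg (hy i).1]
    exact (hy i).2
  set c := min ε (ε / h) with hc
  have hc0 : 0 < c := lt_min hε (div_pos hε hh)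
  refine ⟨h, hh, κ * c ^ n, by positivity, fun t ht hth => ?_⟩
  set τ := t / h with hτ
  have hτ0 : 0 ≤ τ := div_nonneg ht hh.le
  have hτ1 : τ ≤ 1 := (div_le_one hh).2 hth
  have hτh : τ * h = t := div_mul_cancel₀ _ hh.ne'
  have hvolbox := hbox ((1 - τ) • p + τ • q) 0 (fun i => c * if i ∈ s then 1 else t)
    (fun i => by simp only [Pi.zero_apply]; split_ifs <;> positivity)
  simp only [Pi.zero_apply, sub_zero, prod_ite_mem_one, hs, ← mul_assoc] at hvolbox
  rw [← hvolbox]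
  refine measure_mono fun x hx => ?_
  set y : Fin n → ℝ := b.equivFun (x - ((1 - τ) • p + τ • q)) with hy
  have hyi : ∀ i, 0 ≤ y i ∧ y i ≤ c * if i ∈ s then 1 else t := hx
  have hpu : p + b.equivFun.symm (fun i => if i ∈ s then y i else 0) ∈ K := by
    refine hp _ ?_ ((hball _ fun i => ?_).trans_le (min_le_left _ _))
    · rw [Module.Basis.equivFun_symm_apply]
      refine Submodule.sum_mem _ fun i _ => ?_
      split_ifs with hi
      · exact Submodule.smul_mem _ _ (hbs i hi)
      · simp
    · have := hyi i
      split_ifs with hi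
      · rw [if_pos hi, mul_one] at this
        exact ⟨this.1, this.2.trans (min_le_left _ _)⟩
      · exact ⟨le_rfl, hε.le⟩
  have hqv : (Fin.snoc (q + b.equivFun.symm (fun i => if i ∈ s then y i else y i / τ)) h :
      Fin (n + 1) → ℝ) ∈ P := by
    refine hq _ ((hball _ fun i => ?_).trans_le (min_le_right _ _))
    have := hyi i
    split_ifs with hi
    · rw [if_pos hi, mul_one] at this
      exact ⟨this.1, this.2.trans (min_le_left _ _)⟩
    · rw [if_neg hi] at this
      refine ⟨div_nonneg this.1 hτ0, div_le_of_le_mul₀ hτ0 hε.le (this.2.trans ?_)⟩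
      calc c * t ≤ ε / h * t := mul_le_mul_of_nonneg_right (min_le_right _ _) ht
        _ = ε * τ := by rw [hτ]; ring
  have hxeq : x = (1 - τ) • (p + b.equivFun.symm (fun i => if i ∈ s then y i else 0)) +
      τ • (q + b.equivFun.symm (fun i => if i ∈ s then y i else y i / τ)) := by
    have hcomb : y = (1 - τ) • (fun i => if i ∈ s then y i else 0) +
        τ • (fun i => if i ∈ s then y i else y i / τ) := by
      ext i
      have := hyi i
      simp only [Pi.add_apply, Pi.smul_apply, smul_eq_mul]
      split_ifs with hi
      · ring
      · rcases hτ0.eq_or_lt with h0 | h0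
        · rw [if_neg hi, ← hτh, ← h0] at this
          rw [← h0]
          linarith
        · field_simp
          ring
    have := congrArg b.equivFun.symm hcomb
    rw [hy, LinearEquiv.symm_apply_apply, ← hy, map_add, map_smul, map_smul] at this
    rw [smul_add, smul_add, add_add_add_comm, ← this]
    abel
  subst hK
  have := hP hpu hqv (sub_nonneg.2 hτ1) hτ0 (sub_add_cancel _ _)
  rwa [← snoc_convex_combination, ← hxeq, mul_zero, zero_add, hτh] at this

theorem exists_abs_sub_le_of_polyhedron {V : Type*} [AddCommGroup V] [Module ℝ V] {m : ℕ}
    (g : Fin m → V →ᵃ[ℝ] ℝ) (h f : V →ₗ[ℝ] ℝ) (r B : ℝ)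
    (hh : ∀ x, (∀ i, g i x ≤ 0) → 0 ≤ h x) (hne : ∃ x, (∀ i, g i x ≤ 0) ∧ h x = 0)
    (hf : ∀ x, (∀ i, g i x ≤ 0) → h x = 0 → |f x - r| ≤ B) :
    ∃ μ : ℝ, 0 ≤ μ ∧ ∀ x, (∀ i, g i x ≤ 0) → |f x - r| ≤ B + μ * h x := by
  obtain ⟨μ₁, hμ₁, h₁⟩ := exists_le_add_mul_of_polyhedron g h f (B + r) hh hne
    fun x hx hx0 => by linarith [(abs_le.1 (hf x hx hx0)).2]
  obtain ⟨μ₂, hμ₂, h₂⟩ := exists_le_add_mul_of_polyhedron g h (-f) (B - r) hh hne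
    fun x hx hx0 => by rw [LinearMap.neg_apply]; linarith [(abs_le.1 (hf x hx hx0)).1]
  refine ⟨μ₁ + μ₂, by positivity, fun x hx => ?_⟩
  have := h₁ x hx
  have := h₂ x hx
  rw [LinearMap.neg_apply] at this
  have := mul_nonneg hμ₁ (hh x hx)
  have := mul_nonneg hμ₂ (hh x hx)
  rw [abs_le]
  constructor <;> linarith

theorem exists_slice_volume_upper {n m : ℕ} (g : Fin m → (Fin (n + 1) → ℝ) →ᵃ[ℝ] ℝ)
    (hPsub : ∀ x, (∀ i, g i x ≤ 0) → 0 ≤ x (Fin.last n)) {K : Set (Fin n → ℝ)}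
    (hK : K = {x | ∀ i, g i (Fin.snoc x 0) ≤ 0}) (hne : K.Nonempty)
    (hbd : Bornology.IsBounded K) :
    ∃ c > 0, ∀ t : ℝ, 0 ≤ t → t ≤ 1 →
      volume {x : Fin n → ℝ | ∀ i, g i (Fin.snoc x t) ≤ 0} ≤
        ENNReal.ofReal (c * t ^ (n - Module.finrank ℝ (vectorSpan ℝ K))) := by
  obtain ⟨p, hp⟩ := hne
  obtain ⟨R, hR⟩ := hbd.exists_norm_le
  obtain ⟨b, s, hs, -, hbs⟩ := exists_basis_adapted (vectorSpan ℝ K)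
  obtain ⟨κ, hκ, hbox⟩ := exists_volume_basis_box b
  have hcoord : ∀ i, ∃ C : ℝ, 0 ≤ C ∧ ∀ t : ℝ, 0 ≤ t → t ≤ 1 → ∀ x : Fin n → ℝ,
      (∀ j, g j (Fin.snoc x t) ≤ 0) → |b.repr (x - p) i| ≤ C * if i ∈ s then 1 else t := by
    intro i
    have key := fun B : ℝ => exists_abs_sub_le_of_polyhedron g (LinearMap.proj (Fin.last n))
      ((b.coord i).comp (LinearMap.funLeft ℝ ℝ Fin.castSucc)) (b.coord i p) B
      (fun x hx => hPsub x hx) ⟨Fin.snoc p 0, by subst hK; exact hp, by simp⟩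
    have hfun : ∀ (x : Fin n → ℝ) (t : ℝ),
        LinearMap.funLeft ℝ ℝ Fin.castSucc (Fin.snoc x t : Fin (n + 1) → ℝ) = x := fun x t => by
      ext j; simp [LinearMap.funLeft_apply]
    have hmemK : ∀ x : Fin (n + 1) → ℝ, (∀ j, g j x ≤ 0) → x (Fin.last n) = 0 →
        LinearMap.funLeft ℝ ℝ Fin.castSucc x ∈ K := fun x hx hx0 => by
      have hx' : (Fin.snoc (LinearMap.funLeft ℝ ℝ Fin.castSucc x) 0 : Fin (n + 1) → ℝ) = x := by
        rw [← hx0]; exact Fin.snoc_init_self x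
      subst hK
      simpa only [Set.mem_ofPred_eq, hx'] using hx
    by_cases hi : i ∈ s
    · let L := LinearMap.toContinuousLinearMap (b.coord i)
      obtain ⟨μ, hμ, H⟩ := key (‖L‖ * R + |b.coord i p|) fun x hx hx0 => by
        refine (abs_sub _ _).trans (add_le_add_left ?_ _)
        exact (L.le_opNorm _).trans
          (mul_le_mul_of_nonneg_left (hR _ (hmemK x hx hx0)) (norm_nonneg _))
      have hR0 : 0 ≤ R := (norm_nonneg _).trans (hR p hp)
      refine ⟨‖L‖ * R + |b.coord i p| + μ, by positivity, fun t ht ht1 x hx => ?_⟩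
      have := H _ hx
      rw [LinearMap.comp_apply, hfun, ← map_sub, LinearMap.proj_apply, Fin.snoc_last] at this
      rw [if_pos hi, mul_one]
      refine this.trans ?_
      have := mul_le_mul_of_nonneg_left ht1 hμ
      linarith
    · obtain ⟨μ, hμ, H⟩ := key 0 fun x hx hx0 => by
        rw [LinearMap.comp_apply, ← map_sub, Module.Basis.coord_apply, ← vsub_eq_sub,
          hbs i hi _ (vsub_mem_vectorSpan ℝ (hmemK x hx hx0) hp), abs_zero]
      refine ⟨μ, hμ, fun t ht _ x hx => ?_⟩
      have := H _ hx
      rw [LinearMap.comp_apply, hfun, ← map_sub, LinearMap.proj_apply, Fin.snoc_last,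
        zero_add] at this
      rwa [if_neg hi]
  choose C hC0 hC using hcoord
  have hD0 : 0 ≤ ∑ i, C i := Finset.sum_nonneg fun i _ => hC0 i
  set D := ∑ i, C i + 1 with hD
  refine ⟨κ * (2 * D) ^ n, by positivity, fun t ht ht1 => ?_⟩
  have ha : ∀ i, 0 ≤ if i ∈ s then 1 else t := fun i => by split_ifs <;> positivity
  have hvolbox := hbox p (fun i => -(D * if i ∈ s then 1 else t))
    (fun i => D * if i ∈ s then 1 else t)
    (fun i => neg_le_self (mul_nonneg (by positivity) (ha i)))
  simp only [sub_neg_eq_add, ← two_mul, ← mul_assoc] at hvolbox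
  rw [prod_ite_mem_one, hs, ← mul_assoc] at hvolbox
  rw [← hvolbox]
  refine measure_mono fun x hx i => abs_le.1 ((hC i t ht ht1 x hx).trans ?_)
  refine mul_le_mul_of_nonneg_right ?_ (ha i)
  have := Finset.single_le_sum (fun i _ => hC0 i) (Finset.mem_univ i)
  linarith

theorem finrank_vectorSpan_snoc_zero {n : ℕ} (P : Set (Fin (n + 1) → ℝ)) :
    Module.finrank ℝ (vectorSpan ℝ (P ∩ {x | x (Fin.last n) = 0})) =
      Module.finrank ℝ (vectorSpan ℝ {x : Fin n → ℝ | (Fin.snoc x 0 : Fin (n + 1) → ℝ) ∈ P}) := by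
  let ι : (Fin n → ℝ) →ₗ[ℝ] (Fin (n + 1) → ℝ) :=
    { toFun := fun x => Fin.snoc x 0
      map_add' := fun x y => by simpa using snoc_convex_combination 1 1 0 0 x y
      map_smul' := fun a x => by simpa using snoc_convex_combination a 0 0 0 x 0 }
  have hι : Function.Injective ι := fun x y hxy => (Fin.snoc_injective2 (α := fun _ => ℝ) hxy).1
  have himage : P ∩ {x | x (Fin.last n) = 0} =
      ι.toAffineMap '' {x | (Fin.snoc x 0 : Fin (n + 1) → ℝ) ∈ P} := by
    ext x
    constructor
    · rintro ⟨hx, hx0⟩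
      have : (Fin.snoc (Fin.init x) 0 : Fin (n + 1) → ℝ) = x := by
        rw [← show x (Fin.last n) = 0 from hx0]; exact Fin.snoc_init_self x
      exact ⟨Fin.init x, by simpa only [Set.mem_ofPred_eq, this] using hx, this⟩
    · rintro ⟨y, hy, rfl⟩
      exact ⟨hy, by simp [ι]⟩
  rw [himage, ← AffineMap.map_vectorSpan, LinearMap.toAffineMap_linear]
  exact (Submodule.equivMapOfInjective ι hι _).finrank_eq.symm

/-- Let `P ⊆ {x ∈ ℝ^N : x_N ≥ 0}` (here `N = n+1`) be a polyhedron of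
positive `N`-dimensional Lebesgue measure whose base `M = P ∩ {x_N = 0}` is nonempty and
bounded, with affine dimension `d`. Then there exist `δ > 0` and coefficients
`v_{i,k} > 0` (`i = 1,2`, `N−1−d ≤ k ≤ N−1`) such that the slice area function
`S_P(t)` satisfies `p₂(t) ≤ S_P(t) ≤ p₁(t)` for `0 ≤ t ≤ δ`, where
`p_i(t) = Σ_{k=N−1−d}^{N−1} v_{i,k} t^k`. -/
theorem stmt10 (n : ℕ) (P : Set (Fin (n+1) → ℝ))
    (hpoly : ∃ (m : ℕ) (g : Fin m → ((Fin (n+1) → ℝ) →ᵃ[ℝ] ℝ)),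
      P = ⋂ i, {x | g i x ≤ 0})
    (hPsub : ∀ x ∈ P, 0 ≤ x (Fin.last n))
    (hvol : 0 < volume P)
    (hMne : (P ∩ {x | x (Fin.last n) = 0}).Nonempty)
    (hMbd : Bornology.IsBounded (P ∩ {x | x (Fin.last n) = 0})) :
    let d := Module.finrank ℝ
      (affineSpan ℝ (P ∩ {x | x (Fin.last n) = 0})).direction
    ∃ δ : ℝ, 0 < δ ∧ ∃ v₁ v₂ : ℕ → ℝ,
      (∀ k, n - d ≤ k → k ≤ n → 0 < v₁ k ∧ 0 < v₂ k) ∧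
      ∀ t : ℝ, 0 ≤ t → t ≤ δ →
        ENNReal.ofReal (∑ k ∈ Finset.Icc (n - d) n, v₂ k * t ^ k) ≤
          volume {x' : Fin n → ℝ | Fin.snoc x' t ∈ P} ∧
        volume {x' : Fin n → ℝ | Fin.snoc x' t ∈ P} ≤
          ENNReal.ofReal (∑ k ∈ Finset.Icc (n - d) n, v₁ k * t ^ k) := by
  intro d
  obtain ⟨m, g, hg⟩ := hpoly
  have hmem : ∀ x, x ∈ P ↔ ∀ i, g i x ≤ 0 := fun x => by simp [hg]
  set K : Set (Fin n → ℝ) := {x | (Fin.snoc x 0 : Fin (n + 1) → ℝ) ∈ P} with hK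
  have hd : d = Module.finrank ℝ (vectorSpan ℝ K) := by
    rw [← finrank_vectorSpan_snoc_zero, ← direction_affineSpan]
  have hconv : Convex ℝ P := by
    rw [hg]
    exact convex_iInter fun i => (convex_Iic (0 : ℝ)).affine_preimage (g i)
  have hKne : K.Nonempty := by
    obtain ⟨x, hx, hx0⟩ := hMne
    refine ⟨Fin.init x, ?_⟩
    rw [hK, Set.mem_ofPred_eq, ← show x (Fin.last n) = 0 from hx0, Fin.snoc_init_self]
    exact hx
  have hKbd : Bornology.IsBounded K := by
    obtain ⟨R, hR⟩ := hMbd.exists_norm_le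
    refine isBounded_iff_forall_norm_le.2 ⟨R, fun x hx => ?_⟩
    have hxR := hR (Fin.snoc x 0) ⟨hx, by simp⟩
    refine (pi_norm_le_iff_of_nonneg ((norm_nonneg _).trans hxR)).2 fun i => ?_
    simpa using (norm_le_pi_norm _ i.castSucc).trans hxR
  obtain ⟨h, hh, c₂, hc₂, hlow⟩ := exists_slice_volume_lower hconv hPsub hvol hK hKne
  obtain ⟨c₁, hc₁, hupp⟩ := exists_slice_volume_upper g (fun x hx => hPsub x ((hmem x).2 hx))
    (by simp only [hK, hmem]) hKne hKbd
  rw [← hd] at hlow hupp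
  refine ⟨min h 1, lt_min hh one_pos, fun _ => c₁, fun _ => c₂ / (n + 1),
    fun _ _ _ => ⟨hc₁, by positivity⟩, fun t ht htδ => ⟨?_, ?_⟩⟩
  · refine le_trans (ENNReal.ofReal_le_ofReal ?_) (hlow t ht (htδ.trans (min_le_left _ _)))
    have ht1 := htδ.trans (min_le_right _ _)
    have hcard : ((Finset.Icc (n - d) n).card : ℝ) ≤ n + 1 := by
      rw [Nat.card_Icc]
      exact_mod_cast Nat.sub_le _ _
    calc ∑ k ∈ Finset.Icc (n - d) n, c₂ / (n + 1) * t ^ k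
        ≤ ∑ k ∈ Finset.Icc (n - d) n, c₂ / (n + 1) * t ^ (n - d) :=
          Finset.sum_le_sum fun k hk => mul_le_mul_of_nonneg_left
            (pow_le_pow_of_le_one ht ht1 (Finset.mem_Icc.1 hk).1) (by positivity)
      _ = (Finset.Icc (n - d) n).card * (c₂ / (n + 1) * t ^ (n - d)) := by
          rw [Finset.sum_const, nsmul_eq_mul]
      _ ≤ (n + 1) * (c₂ / (n + 1) * t ^ (n - d)) :=
          mul_le_mul_of_nonneg_right hcard (by positivity)
      _ = c₂ * t ^ (n - d) := by field_simp
  · simp only [hmem]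
    refine (hupp t ht (htδ.trans (min_le_right _ _))).trans (ENNReal.ofReal_le_ofReal ?_)
    exact Finset.single_le_sum (f := fun k => c₁ * t ^ k) (fun k _ => by positivity)
      (Finset.mem_Icc.2 ⟨le_rfl, Nat.sub_le _ _⟩)
end

section
/- Assume (A). Then for every (a,s) ∈ 𝔊° with a − b − 𝟏 ≠ 0, one has J_{a,s}(r) ≈ r^{−s−m_{a,s}} · (ln(1/r))^{d_{a,s}} as r → 0⁺, where m_{a,s} = max_{x∈P_{a,s}} φ_a(x) and d_{a,s} is the affine dimension of M_{a,s} = {x ∈ P_{a,s} : φ_a(x) = m_{a,s}}. -/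
open MeasureTheory
open scoped ENNReal Classical

/-- `I(r) = ∫_{(0,1]^N} x^b / (Σ_{(a,s)∈𝔊} x^a r^s) dx`, with values in `[0,∞]`. -/
noncomputable def Ifun (N : ℕ) (G : Finset ((Fin N → ℕ) × ℝ)) (b : Fin N → ℕ)
    (r : ℝ) : ℝ≥0∞ :=
  ∫⁻ x in Set.univ.pi (fun _ : Fin N => Set.Ioc (0 : ℝ) 1),
    ENNReal.ofReal ((∏ i, x i ^ b i) / ∑ p ∈ G, (∏ i, x i ^ p.1 i) * r ^ p.2)

/-- The polyhedron `P_{a,s} = {y ∈ [0,∞)^N : ⟨a − a′, y⟩ ≤ s′ − s for all (a′,s′) ∈ 𝔊}`. -/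
def Pset (N : ℕ) (G : Finset ((Fin N → ℕ) × ℝ)) (a : Fin N → ℕ) (s : ℝ) :
    Set (Fin N → ℝ) :=
  {y | (∀ i, 0 ≤ y i) ∧ ∀ p ∈ G, ∑ i, ((a i : ℝ) - (p.1 i : ℝ)) * y i ≤ p.2 - s}

/-- The linear function `φ_a(y) = ⟨a − b − 𝟏, y⟩`. -/
def phiFun (N : ℕ) (a b : Fin N → ℕ) (y : Fin N → ℝ) : ℝ :=
  ∑ i, ((a i : ℝ) - (b i : ℝ) - 1) * y i

/-- `J_{a,s}(r) = (ln(1/r))^N · r^{−s} · ∫_{P_{a,s}} e^{(ln(1/r)) φ_a(y)} dy`. -/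
noncomputable def Jfun (N : ℕ) (G : Finset ((Fin N → ℕ) × ℝ)) (b : Fin N → ℕ)
    (a : Fin N → ℕ) (s : ℝ) (r : ℝ) : ℝ≥0∞ :=
  ENNReal.ofReal ((Real.log (1/r)) ^ N / r ^ s) *
    ∫⁻ y in Pset N G a s, ENNReal.ofReal (Real.exp (Real.log (1/r) * phiFun N a b y))

/-- `𝔊° = {(a,s) ∈ 𝔊 : P_{a,s} has positive N-dimensional Lebesgue measure}`. -/
noncomputable def Gcirc (N : ℕ) (G : Finset ((Fin N → ℕ) × ℝ)) :
    Finset ((Fin N → ℕ) × ℝ) :=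
  G.filter (fun p => 0 < volume (Pset N G p.1 p.2))

/-- Affine change of variables for the parametrization `t ↦ x₀ + ∑ t_j g_j`. -/
theorem lintegral_eq_det_mul_lintegral_comp {N : ℕ} (g : Fin N → Fin N → ℝ)
    (hg : (Matrix.of g).det ≠ 0) (x₀ : Fin N → ℝ) {f : (Fin N → ℝ) → ℝ≥0∞} (hf : Measurable f) :
    ∫⁻ y, f y =
      ENNReal.ofReal |(Matrix.of g).det| * ∫⁻ t : Fin N → ℝ, f (x₀ + ∑ j, t j • g j) := by
  have hdet : (Matrix.of g).transpose.det ≠ 0 := by rwa [Matrix.det_transpose]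
  have hmap := Real.map_matrix_volume_pi_eq_smul_volume_pi hdet
  have hlin : ∀ t : Fin N → ℝ,
      Matrix.toLin' (Matrix.of g).transpose t = ∑ j, t j • g j := fun t => by
    rw [Matrix.toLin'_apply, Matrix.mulVec_transpose, Matrix.vecMul_eq_sum]; rfl
  have hfx : Measurable fun y => f (x₀ + y) := hf.comp (measurable_const_add x₀)
  have hm : Measurable (Matrix.toLin' (Matrix.of g).transpose) :=
    (LinearMap.continuous_of_finiteDimensional _).measurable
  have h1 : ∫⁻ t : Fin N → ℝ, f (x₀ + ∑ j, t j • g j) =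
      ENNReal.ofReal |((Matrix.of g).det)⁻¹| * ∫⁻ y, f y := by
    rw [← lintegral_add_left_eq_self f x₀, ← smul_eq_mul, ← lintegral_smul_measure,
      ← Matrix.det_transpose, ← hmap, lintegral_map hfx hm]
    simp only [hlin]
  rw [h1, ← mul_assoc, ← ENNReal.ofReal_mul (abs_nonneg _), ← abs_mul, mul_inv_cancel₀ hg]
  simp

theorem det_update_of_sum {N : ℕ} (g : Fin N → Fin N → ℝ) (k : Fin N) (t : Fin N → ℝ) :
    (Matrix.of (Function.update g k (∑ j, t j • g j))).det = t k * (Matrix.of g).det :=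
  Matrix.det_updateRow_sum (Matrix.of g) k t

/-- The solid box `{x₀ + ∑ t_j g_j : 0 ≤ t_j ≤ τ_j}` with `τ_j ≤ 1/N` lies in the polyhedron as
soon as `x₀` and all `x₀ + g_j` do; this gives a lower bound for exponential integrals. -/
theorem ofReal_le_lintegral_polyhedron {N : ℕ} (hN : 1 ≤ N) {ι : Type*} [Countable ι]
    (l : ι → (Fin N → ℝ) →ₗ[ℝ] ℝ) (c : ι → ℝ) (φ : (Fin N → ℝ) →ₗ[ℝ] ℝ)
    {x₀ : Fin N → ℝ} (hx₀ : ∀ i, l i x₀ ≤ c i) (g : Fin N → Fin N → ℝ)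
    (hg : ∀ j i, l i (x₀ + g j) ≤ c i) (hφ : ∀ j, φ (g j) ≤ 0)
    {L : ℝ} (hL : 0 ≤ L) (τ : Fin N → ℝ) (hτ : ∀ j, 0 ≤ τ j) (hτN : ∀ j, τ j ≤ 1 / N) :
    ENNReal.ofReal (|(Matrix.of g).det| * (∏ j, τ j) *
        Real.exp (L * φ x₀ + L * ∑ j, τ j * φ (g j))) ≤
      ∫⁻ y in {y | ∀ i, l i y ≤ c i}, ENNReal.ofReal (Real.exp (L * φ y)) := by
  by_cases hdet : (Matrix.of g).det = 0
  · simp [hdet]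
  have hNpos : (0 : ℝ) < N := by exact_mod_cast hN
  have hlc : ∀ i, Continuous (l i) := fun i => (l i).continuous_of_finiteDimensional
  have hφc : Continuous φ := φ.continuous_of_finiteDimensional
  have hPm : MeasurableSet {y | ∀ i, l i y ≤ c i} := by
    rw [Set.ofPred_forall]
    exact MeasurableSet.iInter fun i => (isClosed_le (hlc i) continuous_const).measurableSet
  have hfm : Measurable fun y => ENNReal.ofReal (Real.exp (L * φ y)) := by fun_prop
  rw [← lintegral_indicator hPm, lintegral_eq_det_mul_lintegral_comp g hdet x₀
    (hfm.indicator hPm)]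
  rw [mul_assoc, ENNReal.ofReal_mul (abs_nonneg _)]
  gcongr
  set B : Set (Fin N → ℝ) := Set.univ.pi fun j => Set.Icc 0 (τ j)
  have hBm : MeasurableSet B := MeasurableSet.univ_pi fun j => measurableSet_Icc
  have hBv : volume B = ENNReal.ofReal (∏ j, τ j) := by
    rw [volume_pi_pi, ENNReal.ofReal_prod_of_nonneg fun j _ => hτ j]
    simp
  rw [ENNReal.ofReal_mul (Finset.prod_nonneg fun j _ => hτ j), ← hBv, mul_comm,
    ← setLIntegral_const, ← lintegral_indicator hBm]
  refine lintegral_mono fun t => ?_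
  by_cases ht : t ∈ B
  swap
  · rw [Set.indicator_of_notMem ht]; exact zero_le
  have ht' : ∀ j, 0 ≤ t j ∧ t j ≤ τ j := fun j => ht j (Set.mem_univ j)
  have hsum : ∑ j, t j ≤ 1 := by
    calc ∑ j, t j ≤ ∑ _j : Fin N, (1 / N : ℝ) :=
          Finset.sum_le_sum fun j _ => (ht' j).2.trans (hτN j)
      _ = 1 := by simp [hNpos.ne']
  have hmem : x₀ + ∑ j, t j • g j ∈ {y | ∀ i, l i y ≤ c i} := fun i => by
    have h1 : ∑ j, t j * l i (g j) ≤ ∑ j, t j * (c i - l i x₀) := by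
      refine Finset.sum_le_sum fun j _ => mul_le_mul_of_nonneg_left ?_ (ht' j).1
      have := hg j i
      rw [map_add] at this
      linarith
    rw [← Finset.sum_mul] at h1
    have h2 : (∑ j, t j) * (c i - l i x₀) ≤ 1 * (c i - l i x₀) :=
      mul_le_mul_of_nonneg_right hsum (sub_nonneg.2 (hx₀ i))
    simp only [map_add, map_sum, map_smul, smul_eq_mul]
    linarith
  rw [Set.indicator_of_mem ht, Set.indicator_of_mem hmem]
  refine ENNReal.ofReal_le_ofReal (Real.exp_le_exp.2 ?_)
  simp only [map_add, map_sum, map_smul, smul_eq_mul]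
  rw [mul_add]
  gcongr L * φ x₀ + L * ?_
  exact Finset.sum_le_sum fun j _ => mul_le_mul_of_nonpos_right (ht' j).2 (hφ j)

theorem integrable_exp_neg_mul_abs {α : ℝ} (hα : 0 < α) :
    Integrable fun t : ℝ => Real.exp (-(α * |t|)) := by
  rw [← integrableOn_univ, ← Set.Iic_union_Ioi (a := (0 : ℝ)), integrableOn_union]
  constructor
  · refine (integrableOn_exp_mul_Iic hα 0).congr_fun (fun t ht => ?_) measurableSet_Iic
    simp only [abs_of_nonpos (Set.mem_Iic.1 ht), mul_neg, neg_neg]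
  · refine (integrableOn_exp_mul_Ioi (neg_lt_zero.2 hα) 0).congr_fun (fun t ht => ?_)
      measurableSet_Ioi
    simp only [abs_of_pos (Set.mem_Ioi.1 ht), neg_mul]

theorem lintegral_exp_neg_sum_mul_abs {N : ℕ} {α : Fin N → ℝ} (hα : ∀ j, 0 < α j) :
    ∫⁻ t : Fin N → ℝ, ENNReal.ofReal (Real.exp (-∑ j, α j * |t j|)) =
      ENNReal.ofReal (∏ j, (2 / α j)) := by
  have h1 : ∀ t : Fin N → ℝ, Real.exp (-∑ j, α j * |t j|) = ∏ j, Real.exp (-(α j * |t j|)) :=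
    fun t => by rw [← Real.exp_sum, Finset.sum_neg_distrib]
  simp_rw [h1]
  rw [volume_pi, ← ofReal_integral_eq_lintegral_ofReal
    (Integrable.fintype_prod fun j => integrable_exp_neg_mul_abs (hα j))
    (Filter.Eventually.of_forall fun t => Finset.prod_nonneg fun j _ => (Real.exp_pos _).le),
    ← volume_pi, integral_fintype_prod_volume_eq_prod fun j (t : ℝ) => Real.exp (-(α j * |t|))]
  congr 1
  refine Finset.prod_congr rfl fun j _ => ?_
  rw [integral_comp_abs (f := fun t => Real.exp (-(α j * t)))]
  have := integral_exp_mul_Ioi (neg_lt_zero.2 (hα j)) 0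
  simp only [neg_mul] at this
  rw [this]
  simp [div_eq_mul_inv]

/-- The substitution `x = e^{-y}` shows that finiteness of `I` at `r = e^{-1}` forces the
integrability of `e^{φ_a}` on `P_{a,s}`. -/
theorem lintegral_Pset_exp_lt_top {N : ℕ} {G : Finset ((Fin N → ℕ) × ℝ)} {b : Fin N → ℕ}
    (hI : Ifun N G b (Real.exp (-1)) < ⊤) {p : (Fin N → ℕ) × ℝ} (hp : p ∈ G)
    (hPm : MeasurableSet (Pset N G p.1 p.2)) :
    ∫⁻ y in Pset N G p.1 p.2, ENNReal.ofReal (Real.exp (phiFun N p.1 b y)) < ⊤ := by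
  set P := Pset N G p.1 p.2 with hP
  set F : (Fin N → ℝ) → Fin N → ℝ := fun y i => Real.exp (-y i)
  set F' : (Fin N → ℝ) → (Fin N → ℝ) →L[ℝ] (Fin N → ℝ) := fun y =>
    ContinuousLinearMap.pi fun i =>
      (-Real.exp (-y i)) • ContinuousLinearMap.proj (R := ℝ) (φ := fun _ : Fin N => ℝ) i
  have hF : ∀ y ∈ P, HasFDerivWithinAt F (F' y) P y := fun y _ => by
    rw [hasFDerivWithinAt_pi]
    intro i
    have h1 : HasFDerivAt (fun y : Fin N → ℝ => y i)
        (ContinuousLinearMap.proj (R := ℝ) (φ := fun _ : Fin N => ℝ) i) y :=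
      hasFDerivAt_apply i y
    have h2 : HasFDerivAt (fun y : Fin N → ℝ => Real.exp (-y i)) (Real.exp (-y i) •
        -ContinuousLinearMap.proj (R := ℝ) (φ := fun _ : Fin N => ℝ) i) y := h1.neg.exp
    refine HasFDerivAt.hasFDerivWithinAt (h2.congr_fderiv ?_)
    ext v
    simp
  have hFinj : Set.InjOn F P := fun y _ z _ h => by
    ext i
    have := congrFun h i
    exact neg_injective (Real.exp_injective this)
  have hdet : ∀ y, |(F' y).det| = Real.exp (-∑ i, y i) := fun y => by
    have : (F' y).det = ∏ i, -Real.exp (-y i) := by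
      have h3 : ((F' y : (Fin N → ℝ) →L[ℝ] (Fin N → ℝ)) : (Fin N → ℝ) →ₗ[ℝ] (Fin N → ℝ)) =
          Matrix.toLin' (Matrix.diagonal fun i => -Real.exp (-y i)) := by
        apply LinearMap.ext
        intro v
        ext i
        simp [F', Matrix.mulVec_diagonal]
      rw [ContinuousLinearMap.det, h3, LinearMap.det_toLin', Matrix.det_diagonal]
    rw [this, Finset.abs_prod, ← Finset.sum_neg_distrib, Real.exp_sum]
    simp
  have hsub : F '' P ⊆ Set.univ.pi (fun _ : Fin N => Set.Ioc (0 : ℝ) 1) := by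
    rintro _ ⟨y, hy, rfl⟩ i -
    exact ⟨Real.exp_pos _, Real.exp_le_one_iff.2 (neg_nonpos.2 (hy.1 i))⟩
  have hmon : ∀ (y : Fin N → ℝ) (k : Fin N → ℕ),
      ∏ i, F y i ^ k i = Real.exp (-∑ i, (k i : ℝ) * y i) := fun y k => by
    rw [← Finset.sum_neg_distrib, Real.exp_sum]
    refine Finset.prod_congr rfl fun i _ => ?_
    rw [← Real.exp_nat_mul, mul_neg]
  have hcard : (0 : ℝ) < G.card := by exact_mod_cast Finset.card_pos.2 ⟨p, hp⟩
  have hkey : ENNReal.ofReal (Real.exp p.2 / G.card) *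
      ∫⁻ y in P, ENNReal.ofReal (Real.exp (phiFun N p.1 b y)) ≤ Ifun N G b (Real.exp (-1)) := by
    refine le_trans ?_ (lintegral_mono_set hsub)
    rw [lintegral_image_eq_lintegral_abs_det_fderiv_mul volume hPm hF hFinj,
      ← lintegral_const_mul' _ _ ENNReal.ofReal_ne_top]
    refine setLIntegral_mono' hPm fun y hy => ?_
    rw [← ENNReal.ofReal_mul (by positivity), ← ENNReal.ofReal_mul (abs_nonneg _), hdet]
    refine ENNReal.ofReal_le_ofReal ?_
    simp only [hmon, ← Real.exp_mul, ← Real.exp_add]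
    have hden : ∑ q ∈ G, Real.exp (-∑ i, (q.1 i : ℝ) * y i + -1 * q.2) ≤
        G.card * Real.exp (-∑ i, (p.1 i : ℝ) * y i - p.2) := by
      rw [← nsmul_eq_mul]
      refine Finset.sum_le_card_nsmul _ _ _ fun q hq => Real.exp_le_exp.2 ?_
      have := hy.2 q hq
      simp only [sub_mul, Finset.sum_sub_distrib] at this
      linarith
    have hdenpos : 0 < ∑ q ∈ G, Real.exp (-∑ i, (q.1 i : ℝ) * y i + -1 * q.2) :=
      Finset.sum_pos (fun q _ => Real.exp_pos _) ⟨p, hp⟩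
    calc Real.exp p.2 / G.card * Real.exp (phiFun N p.1 b y)
        = Real.exp (-∑ i, y i) * (Real.exp (-∑ i, (b i : ℝ) * y i) /
          (G.card * Real.exp (-∑ i, (p.1 i : ℝ) * y i - p.2))) := by
          have h4 : Real.exp p.2 * Real.exp (phiFun N p.1 b y) *
              Real.exp (-∑ i, (p.1 i : ℝ) * y i - p.2) =
              Real.exp (-∑ i, y i) * Real.exp (-∑ i, (b i : ℝ) * y i) := by
            rw [← Real.exp_add, ← Real.exp_add, ← Real.exp_add]
            congr 1
            simp only [phiFun, sub_mul, one_mul, Finset.sum_sub_distrib]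
            ring
          field_simp
          linarith
      _ ≤ _ := by gcongr
  by_contra htop
  rw [not_lt, top_le_iff] at htop
  rw [htop, ENNReal.mul_top (by simpa using by positivity)] at hkey
  exact absurd hI (not_lt.2 hkey)

/-- A point of a face of a polyhedron whose active constraints are active on the whole face. -/
theorem exists_mem_forall_active {E ι : Type*} [AddCommGroup E] [Module ℝ E] [Fintype ι]
    (l : ι → E →ₗ[ℝ] ℝ) (c : ι → ℝ) {M : Set E} (hM : Convex ℝ M) (hne : M.Nonempty)
    (hMP : ∀ x ∈ M, ∀ i, l i x ≤ c i) :
    ∃ x₀ ∈ M, ∀ y ∈ M, ∀ i, l i x₀ = c i → l i y = c i := by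
  set A : E → Finset ι := fun x => Finset.univ.filter fun i => l i x = c i with hA
  obtain ⟨x₀, hx₀, hmin⟩ := (measure fun x => (A x).card).wf.has_min M hne
  refine ⟨x₀, hx₀, fun y hy i hi => ?_⟩
  set z : E := (1 / 2 : ℝ) • x₀ + (1 / 2 : ℝ) • y
  have hz : z ∈ M := hM hx₀ hy (by norm_num) (by norm_num) (by norm_num)
  have hlz : ∀ i, l i z = 1 / 2 * l i x₀ + 1 / 2 * l i y := fun i => by simp [z]
  have hsub : A z ⊆ A x₀ := fun i hi => by
    simp only [hA, Finset.mem_filter, Finset.mem_univ, true_and, hlz] at hi ⊢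
    linarith [hMP x₀ hx₀ i, hMP y hy i]
  have heq : A z = A x₀ := Finset.eq_of_subset_of_card_le hsub (not_lt.1 (hmin z hz))
  have hiz : i ∈ A z := by rw [heq]; simp [hA, hi]
  simp only [hA, Finset.mem_filter, Finset.mem_univ, true_and, hlz] at hiz
  linarith [hMP x₀ hx₀ i, hMP y hy i]

theorem span_sub_image_eq_top {N : ℕ} {P : Set (Fin N → ℝ)} (hP : 0 < volume P)
    (x₀ : Fin N → ℝ) : Submodule.span ℝ ((· - x₀) '' P) = ⊤ := by
  by_contra h
  have h0 := Measure.addHaar_submodule volume _ h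
  have hsub : P ⊆ (fun y => y + -x₀) ⁻¹' (Submodule.span ℝ ((· - x₀) '' P) : Set (Fin N → ℝ)) :=
    fun y hy => Submodule.subset_span ⟨y, hy, sub_eq_add_neg y x₀⟩
  have h1 := measure_mono (μ := volume) hsub
  rw [measure_preimage_add_right, h0] at h1
  exact absurd hP (not_lt.2 h1)

/-- A basis of `ℝ^N` made of differences `y - x₀` with `y ∈ P`, part of which is a basis of the
direction of the affine span of `M`, made of differences `y - x₀` with `y ∈ M`. -/
theorem exists_basis_adapted_s12 {N : ℕ} {P M : Set (Fin N → ℝ)} (hP : 0 < volume P) (hMP : M ⊆ P)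
    {x₀ : Fin N → ℝ} (hx₀ : x₀ ∈ M) :
    ∃ (g : Module.Basis (Fin N) ℝ (Fin N → ℝ)) (D : Finset (Fin N)),
      (∀ j, x₀ + g j ∈ P) ∧ (∀ j ∈ D, x₀ + g j ∈ M) ∧
      Submodule.span ℝ (g '' D) = (affineSpan ℝ M).direction ∧
      D.card = Module.finrank ℝ (affineSpan ℝ M).direction := by
  obtain ⟨s, hsM, hspan, hli⟩ := exists_linearIndependent ℝ ((· - x₀) '' M)
  obtain ⟨b, hbP, hsb, hPb, hbli⟩ :=
    exists_linearIndepOn_id_extension (K := ℝ) hli (hsM.trans (Set.image_mono hMP))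
  have hbtop : ⊤ ≤ Submodule.span ℝ (Set.range ((↑) : b → Fin N → ℝ)) := by
    rw [Subtype.range_coe, ← span_sub_image_eq_top hP x₀, Submodule.span_le]
    exact hPb
  set B := Module.Basis.mk hbli hbtop
  have : Fintype b := FiniteDimensional.fintypeBasisIndex B
  have hcard : Fintype.card b = N := by
    rw [← Module.finrank_eq_card_basis B]; simp
  set e := Fintype.equivFinOfCardEq hcard
  set g := B.reindex e
  have hgb : ∀ j, g j = (e.symm j : Fin N → ℝ) := fun j => by
    rw [Module.Basis.reindex_apply]; exact Module.Basis.mk_apply hbli hbtop _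
  set D : Finset (Fin N) := Finset.univ.filter fun j => g j ∈ s with hD
  have hgD : g '' D = s := by
    ext v
    constructor
    · rintro ⟨j, hj, rfl⟩
      simpa [hD] using hj
    · intro hv
      have hgv : g (e ⟨v, hsb hv⟩) = v := by rw [hgb]; simp
      exact ⟨e ⟨v, hsb hv⟩, by simp [hD, hgv, hv], hgv⟩
  have hdir : Submodule.span ℝ s = (affineSpan ℝ M).direction := by
    rw [hspan, direction_affineSpan, vectorSpan_eq_span_vsub_set_right ℝ hx₀]
    rfl
  refine ⟨g, D, fun j => ?_, fun j hj => ?_, by rw [hgD, hdir], ?_⟩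
  · obtain ⟨y, hy, hyj⟩ := hbP (e.symm j).2
    rw [hgb, ← hyj]
    simpa using hy
  · obtain ⟨y, hy, hyj⟩ := hsM (Finset.mem_filter.1 hj).2
    rw [← hyj]
    simpa using hy
  · have hDs : ((D.image g : Finset (Fin N → ℝ)) : Set (Fin N → ℝ)) = s := by
      rw [Finset.coe_image, hgD]
    rw [← hdir, ← hDs, finrank_span_finset_eq_card (by rw [hDs]; exact hli),
      Finset.card_image_of_injective _ g.injective]

/-- If `e^φ` is integrable on a polyhedron, then the size of a point is bounded linearly by how
far `φ` lies below its maximum there. -/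
theorem exists_abs_coord_le {N : ℕ} (hN : 1 ≤ N) {ι : Type*} [Countable ι]
    (l : ι → (Fin N → ℝ) →ₗ[ℝ] ℝ) (c : ι → ℝ) (φ : (Fin N → ℝ) →ₗ[ℝ] ℝ)
    {x₀ : Fin N → ℝ} (hx₀ : ∀ i, l i x₀ ≤ c i)
    (hmax : ∀ y, (∀ i, l i y ≤ c i) → φ y ≤ φ x₀)
    (hfin : ∫⁻ y in {y | ∀ i, l i y ≤ c i}, ENNReal.ofReal (Real.exp (φ y)) < ⊤)
    (g : Fin N → Fin N → ℝ) (hdet : (Matrix.of g).det ≠ 0)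
    (hg : ∀ j i, l i (x₀ + g j) ≤ c i) :
    ∃ R : ℝ, 0 < R ∧ ∀ t : Fin N → ℝ, (∀ i, l i (x₀ + ∑ j, t j • g j) ≤ c i) →
      ∀ k, |t k| ≤ R * (1 - φ (∑ j, t j • g j)) := by
  have hNpos : (0 : ℝ) < N := by exact_mod_cast hN
  have hφ : ∀ u, (∀ i, l i (x₀ + u) ≤ c i) → φ u ≤ 0 := fun u hu => by
    have := hmax _ hu
    rw [map_add] at this
    linarith
  set K := ∫⁻ y in {y | ∀ i, l i y ≤ c i}, ENNReal.ofReal (Real.exp (φ y))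
  set E : ℝ := |(Matrix.of g).det| * (1 / N : ℝ) ^ N *
    Real.exp (φ x₀ + ∑ j, (1 / N : ℝ) * (φ (g j) - 1))
  have hE : 0 < E := by have := abs_pos.2 hdet; positivity
  set R := K.toReal / E + 1
  have hR : 0 < R := by positivity
  have hsmall : ∀ t : Fin N → ℝ, (∀ i, l i (x₀ + ∑ j, t j • g j) ≤ c i) →
      -1 ≤ φ (∑ j, t j • g j) → ∀ k, |t k| ≤ R := fun t ht ht1 k => by
    set u := ∑ j, t j • g j with hu
    have hgu : ∀ j, Function.update g k u j = g j ∨ Function.update g k u j = u := fun j => by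
      by_cases h : j = k
      · subst h; simp
      · simp [h]
    have h1 := ofReal_le_lintegral_polyhedron hN l c φ hx₀ (Function.update g k u)
      (fun j i => by rcases hgu j with h | h <;> rw [h]; exacts [hg j i, ht i])
      (fun j => by rcases hgu j with h | h <;> rw [h]; exacts [hφ _ (hg j), hφ _ ht])
      zero_le_one (fun _ => 1 / N) (fun _ => by positivity) (fun _ => le_rfl)
    simp only [one_mul] at h1
    rw [ENNReal.ofReal_le_iff_le_toReal hfin.ne, hu, det_update_of_sum, ← hu, abs_mul,
      Finset.prod_const, Finset.card_univ, Fintype.card_fin] at h1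
    have h2 : |t k| * E ≤ K.toReal := by
      refine le_trans ?_ h1
      rw [mul_assoc, mul_assoc, ← mul_assoc |(Matrix.of g).det|]
      gcongr |t k| * (_ * Real.exp (φ x₀ + ?_))
      refine Finset.sum_le_sum fun j _ => mul_le_mul_of_nonneg_left ?_ (by positivity)
      rcases hgu j with h | h <;> rw [h]
      · linarith
      · linarith [hφ _ (hg j)]
    have h3 : |t k| ≤ K.toReal / E := (le_div_iff₀ hE).2 h2
    linarith
  refine ⟨R, hR, fun t ht k => ?_⟩
  have hu := hφ _ ht
  set u := ∑ j, t j • g j with hu_def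
  by_cases h1 : -1 ≤ φ u
  · exact (hsmall t ht h1 k).trans (le_mul_of_one_le_right hR.le (by linarith))
  · set δ := -φ u with hδ
    have hδ1 : 1 < δ := by linarith
    have hsc : ∑ j, (δ⁻¹ • t) j • g j = δ⁻¹ • u := by
      simp [hu_def, Finset.smul_sum, smul_smul]
    have h2 := hsmall (δ⁻¹ • t) (fun i => by
        rw [hsc]
        have h3 := ht i
        have h4 := hx₀ i
        simp only [map_add, map_smul, smul_eq_mul] at h3 ⊢
        have h5 : δ⁻¹ ≤ 1 := inv_le_one_of_one_le₀ hδ1.le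
        have h6 : 0 < δ⁻¹ := by positivity
        nlinarith [mul_le_mul_of_nonneg_left (show l i u ≤ c i - l i x₀ by linarith) h6.le,
          mul_le_mul_of_nonneg_right h5 (sub_nonneg.2 h4)]) (by
        rw [hsc, map_smul, smul_eq_mul, show φ u = -δ by simp [hδ], mul_neg,
          inv_mul_cancel₀ (by positivity)]) k
    rw [Pi.smul_apply, smul_eq_mul, abs_mul, abs_of_pos (by positivity), inv_mul_le_iff₀
      (by positivity)] at h2
    nlinarith

/-- Sharpness of the maximum of a linear function over a polyhedron, transversally to the
maximal face. -/
theorem exists_mul_abs_coord_le {N : ℕ} {ι : Type*} [Finite ι]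
    (l : ι → (Fin N → ℝ) →ₗ[ℝ] ℝ) (c : ι → ℝ) (φ : (Fin N → ℝ) →ₗ[ℝ] ℝ)
    {x₀ : Fin N → ℝ} (hx₀ : ∀ i, l i x₀ ≤ c i)
    (hmax : ∀ y, (∀ i, l i y ≤ c i) → φ y ≤ φ x₀)
    (g : Fin N → Fin N → ℝ) (D : Finset (Fin N)) (hDφ : ∀ j ∈ D, φ (g j) = 0)
    (hDl : ∀ j ∈ D, ∀ i, l i x₀ = c i → l i (g j) = 0)
    (hface : ∀ t : Fin N → ℝ, (∀ i, l i (x₀ + ∑ j, t j • g j) ≤ c i) →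
      φ (∑ j, t j • g j) = 0 → ∀ j ∉ D, t j = 0) :
    ∃ κ : ℝ, 0 < κ ∧ ∀ t : Fin N → ℝ, (∀ i, l i (x₀ + ∑ j, t j • g j) ≤ c i) →
      ∀ j ∉ D, κ * |t j| ≤ -φ (∑ j, t j • g j) := by
  set E : (Fin N → ℝ) → Fin N → ℝ := fun t => ∑ j, t j • g j with hE
  have hEs : ∀ (a : ℝ) t, E (a • t) = a • E t := fun a t => by
    simp [hE, Finset.smul_sum, smul_smul]
  have hEc : Continuous E := by fun_prop
  have hlc : ∀ i, Continuous (l i) := fun i => (l i).continuous_of_finiteDimensional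
  have hφc : Continuous φ := φ.continuous_of_finiteDimensional
  set S : Set (Fin N → ℝ) :=
    Metric.sphere 0 1 ∩ {t | (∀ j ∈ D, t j = 0) ∧ ∀ i, l i x₀ = c i → l i (E t) ≤ 0}
  have hS : IsCompact S := by
    refine (isCompact_sphere 0 1).inter_right ?_
    simp only [Set.ofPred_and, Set.ofPred_forall]
    refine IsClosed.inter ?_ ?_
    · exact isClosed_iInter fun j => isClosed_iInter fun _ =>
        isClosed_eq (continuous_apply j) continuous_const
    · exact isClosed_iInter fun i => isClosed_iInter fun _ =>
        isClosed_le ((hlc i).comp hEc) continuous_const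
  have hpos : ∀ t ∈ S, 0 < -φ (E t) := by
    rintro t ⟨ht1, htD, htl⟩
    have hev : ∀ i, ∀ᶠ ε : ℝ in nhdsWithin 0 (Set.Ioi 0), l i (x₀ + ε • E t) ≤ c i := fun i => by
      rcases (hx₀ i).eq_or_lt with h | h
      · filter_upwards [self_mem_nhdsWithin] with ε hε
        have := mul_nonpos_of_nonneg_of_nonpos (Set.mem_Ioi.1 hε).le (htl i h)
        simp only [map_add, map_smul, smul_eq_mul]
        linarith
      · have hcont : Continuous fun ε : ℝ => l i (x₀ + ε • E t) := (hlc i).comp (by fun_prop)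
        have : ∀ᶠ ε : ℝ in nhds 0, l i (x₀ + ε • E t) < c i :=
          hcont.continuousAt.eventually_lt continuousAt_const (by simpa using h)
        exact (this.filter_mono nhdsWithin_le_nhds).mono fun _ h => h.le
    obtain ⟨ε, hε, hε0⟩ := ((Filter.eventually_all.2 hev).and self_mem_nhdsWithin).exists
    have hε0 : 0 < ε := hε0
    have h1 := hmax _ hε
    simp only [map_add, map_smul, smul_eq_mul] at h1
    by_contra hneg
    have h2 : φ (E t) = 0 := by nlinarith
    have h3 := hface (ε • t) (by change ∀ i, l i (x₀ + E (ε • t)) ≤ c i; rwa [hEs])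
      (by change φ (E (ε • t)) = 0; rw [hEs, map_smul, h2, smul_zero])
    have h4 : t = 0 := by
      ext j
      by_cases hj : j ∈ D
      · exact htD j hj
      · have := h3 j hj
        simpa [hε0.ne'] using this
    simp [h4] at ht1
  obtain ⟨κ, hκ, hκS⟩ : ∃ κ : ℝ, 0 < κ ∧ ∀ t ∈ S, κ ≤ -φ (E t) := by
    rcases S.eq_empty_or_nonempty with h | h
    · exact ⟨1, one_pos, by simp [h]⟩
    · obtain ⟨t₀, ht₀, hmin⟩ := hS.exists_isMinOn h (f := fun t => -φ (E t)) (by fun_prop)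
      exact ⟨-φ (E t₀), hpos t₀ ht₀, fun t ht => hmin ht⟩
  refine ⟨κ, hκ, fun t ht j hj => ?_⟩
  set w : Fin N → ℝ := fun k => if k ∈ D then 0 else t k with hw
  have hlin : ∀ f : (Fin N → ℝ) →ₗ[ℝ] ℝ, (∀ k ∈ D, f (g k) = 0) → f (E w) = f (E t) :=
    fun f hf => by
      simp only [hE, map_sum, map_smul, smul_eq_mul]
      refine Finset.sum_congr rfl fun k _ => ?_
      by_cases hk : k ∈ D <;> simp [hw, hk, hf]
  have hwj : w j = t j := by simp [hw, hj]
  change κ * |t j| ≤ -φ (E t)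
  rw [← hlin φ hDφ, ← hwj]
  rcases eq_or_ne w 0 with h0 | h0
  · simp [h0, hE]
  have hn : 0 < ‖w‖ := norm_pos_iff.2 h0
  have hwS : ‖w‖⁻¹ • w ∈ S := by
    refine ⟨by simp [norm_smul, hn.ne'], fun k hk => by simp [hw, hk], fun i hi => ?_⟩
    rw [hEs, map_smul, smul_eq_mul, hlin (l i) fun k hk => hDl k hk i hi]
    have := ht i
    rw [map_add, hi] at this
    exact mul_nonpos_of_nonneg_of_nonpos (by positivity) (by linarith)
  have h1 := hκS _ hwS
  rw [hEs, map_smul, smul_eq_mul, ← mul_neg, inv_mul_eq_div, le_div_iff₀ hn] at h1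
  have h2 : |w j| ≤ ‖w‖ := norm_le_pi_norm w j
  exact (mul_le_mul_of_nonneg_left h2 hκ.le).trans h1

/-- Laplace asymptotics over a polyhedron: if `φ` is linear with maximum `m` attained on a face of
affine dimension `d`, then `L^N ∫_P e^{Lφ}` is comparable to `L^d e^{Lm}` for `L ≥ 1`. -/
theorem exists_lintegral_exp_polyhedron_bounds {N : ℕ} (hN : 1 ≤ N) {ι : Type*} [Finite ι]
    (l : ι → (Fin N → ℝ) →ₗ[ℝ] ℝ) (c : ι → ℝ) (φ : (Fin N → ℝ) →ₗ[ℝ] ℝ)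
    (hvol : 0 < volume {y | ∀ i, l i y ≤ c i})
    (hfin : ∫⁻ y in {y | ∀ i, l i y ≤ c i}, ENNReal.ofReal (Real.exp (φ y)) < ⊤)
    {m : ℝ} (hm : IsGreatest (φ '' {y | ∀ i, l i y ≤ c i}) m) {d : ℕ}
    (hd : d = Module.finrank ℝ
      (affineSpan ℝ {x ∈ {y | ∀ i, l i y ≤ c i} | φ x = m}).direction) :
    ∃ C : ℝ, 1 ≤ C ∧ ∀ L : ℝ, 1 ≤ L →
      ENNReal.ofReal (C⁻¹ * (L ^ d * Real.exp (L * m))) ≤ ENNReal.ofReal (L ^ N) *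
        ∫⁻ y in {y | ∀ i, l i y ≤ c i}, ENNReal.ofReal (Real.exp (L * φ y)) ∧
      ENNReal.ofReal (L ^ N) *
        ∫⁻ y in {y | ∀ i, l i y ≤ c i}, ENNReal.ofReal (Real.exp (L * φ y)) ≤
        ENNReal.ofReal (C * (L ^ d * Real.exp (L * m))) := by
  have : Fintype ι := Fintype.ofFinite ι
  have hNpos : (0 : ℝ) < N := by exact_mod_cast hN
  set P : Set (Fin N → ℝ) := {y | ∀ i, l i y ≤ c i} with hP
  set M : Set (Fin N → ℝ) := {x ∈ P | φ x = m} with hM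
  have hPm : MeasurableSet P := by
    rw [hP, Set.ofPred_forall]
    exact MeasurableSet.iInter fun i =>
      (isClosed_le (l i).continuous_of_finiteDimensional continuous_const).measurableSet
  have hPconv : Convex ℝ P := by
    rw [hP, Set.ofPred_forall]
    exact convex_iInter fun i => convex_halfSpace_le (l i).isLinear (c i)
  have hMconv : Convex ℝ M := hPconv.inter (convex_hyperplane φ.isLinear m)
  have hMne : M.Nonempty := by
    obtain ⟨x, hx, hxm⟩ := hm.1
    exact ⟨x, hx, hxm⟩
  have hφc : Continuous φ := φ.continuous_of_finiteDimensional
  obtain ⟨x₀, hx₀, hact⟩ := exists_mem_forall_active l c hMconv hMne fun x hx => hx.1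
  obtain ⟨g, D, hgP, hgM, hspan, hcard⟩ := exists_basis_adapted_s12 hvol (Set.sep_subset P _) hx₀
  have hmax : ∀ y, (∀ i, l i y ≤ c i) → φ y ≤ φ x₀ := fun y hy => by
    rw [hx₀.2]
    exact hm.2 ⟨y, hy, rfl⟩
  have hdet : (Matrix.of g).det ≠ 0 := by
    have : LinearIndependent ℝ (Matrix.of g).row := g.linearIndependent
    exact ((Matrix.isUnit_iff_isUnit_det _).1
      (Matrix.linearIndependent_rows_iff_isUnit.1 this)).ne_zero
  have hφg : ∀ j, φ (g j) ≤ 0 := fun j => by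
    have := hmax _ (hgP j)
    rw [map_add] at this
    linarith
  have hDφ : ∀ j ∈ D, φ (g j) = 0 := fun j hj => by
    have := (hgM j hj).2
    rw [map_add, hx₀.2] at this
    linarith
  have hDl : ∀ j ∈ D, ∀ i, l i x₀ = c i → l i (g j) = 0 := fun j hj i hi => by
    have := hact _ (hgM j hj) i hi
    rw [map_add, hi] at this
    linarith
  have hface : ∀ t : Fin N → ℝ, (∀ i, l i (x₀ + ∑ j, t j • g j) ≤ c i) →
      φ (∑ j, t j • g j) = 0 → ∀ j ∉ D, t j = 0 := fun t ht ht0 j hj => by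
    have hmem : x₀ + ∑ j, t j • g j ∈ M := ⟨ht, by rw [map_add, ht0, hx₀.2, add_zero]⟩
    have hdir : ∑ j, t j • g j ∈ Submodule.span ℝ (g '' D) := by
      rw [hspan]
      have := AffineSubspace.vsub_mem_direction (subset_affineSpan ℝ M hmem)
        (subset_affineSpan ℝ M hx₀)
      simpa using this
    rw [Module.Basis.mem_span_image] at hdir
    by_contra hne
    refine hj (hdir ?_)
    rw [Finset.mem_coe, Finsupp.mem_support_iff, Module.Basis.repr_sum_self]
    exact hne
  obtain ⟨R, hR, hRt⟩ := exists_abs_coord_le hN l c φ hx₀.1 hmax hfin g hdet hgP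
  obtain ⟨κ, hκ, hκt⟩ := exists_mul_abs_coord_le l c φ hx₀.1 hmax g D hDφ hDl hface
  have hLd : ∀ L : ℝ, ∏ j : Fin N, (if j ∈ D then L else 1) = L ^ d := fun L => by
    rw [Finset.prod_ite_mem, Finset.univ_inter, Finset.prod_const, hcard, hd]
  set Clow : ℝ := |(Matrix.of g).det| * (1 / N : ℝ) ^ N * Real.exp (∑ j, (1 / N : ℝ) * φ (g j))
  set Cup : ℝ := |(Matrix.of g).det| * (∏ j, if j ∈ D then 2 * N * R else 2 * N / κ) * Real.exp 1
  have hClow : 0 < Clow := by have := abs_pos.2 hdet; positivity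
  refine ⟨max 1 (max Clow⁻¹ Cup), le_max_left _ _, fun L hL => ?_⟩
  have hL0 : 0 < L := one_pos.trans_le hL
  constructor
  · set τ : Fin N → ℝ := fun j => if j ∈ D then 1 / N else 1 / N * L⁻¹ with hτ
    have h1 := ofReal_le_lintegral_polyhedron hN l c φ hx₀.1 g hgP hφg hL0.le τ
      (fun j => by simp only [hτ]; split_ifs <;> positivity)
      (fun j => by
        simp only [hτ]
        split_ifs
        · exact le_rfl
        · exact mul_le_of_le_one_right (by positivity) (inv_le_one_of_one_le₀ hL))
    have hsum : L * ∑ j, τ j * φ (g j) = ∑ j, (1 / N : ℝ) * φ (g j) := by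
      rw [Finset.mul_sum]
      refine Finset.sum_congr rfl fun j _ => ?_
      by_cases hj : j ∈ D
      · simp [hDφ j hj]
      · simp only [hτ, hj, if_false]
        field_simp
    have hprod : L ^ N * ∏ j, τ j = (1 / N : ℝ) ^ N * L ^ d := by
      rw [← hLd]
      have h2 : ∀ a : ℝ, a ^ N = ∏ _j : Fin N, a := fun a => by simp
      rw [h2 L, h2 (1 / N), ← Finset.prod_mul_distrib, ← Finset.prod_mul_distrib]
      refine Finset.prod_congr rfl fun j _ => ?_
      by_cases hj : j ∈ D
      · simp only [hτ, hj, if_true]; ring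
      · simp only [hτ, hj, if_false]; field_simp
    refine le_trans ?_ (mul_le_mul_right h1 _)
    rw [← ENNReal.ofReal_mul (by positivity), hsum, hx₀.2]
    refine ENNReal.ofReal_le_ofReal ?_
    calc (max 1 (max Clow⁻¹ Cup))⁻¹ * (L ^ d * Real.exp (L * m))
        ≤ Clow * (L ^ d * Real.exp (L * m)) := by
          gcongr
          exact inv_le_of_inv_le₀ hClow ((le_max_left _ _).trans (le_max_right _ _))
      _ = |(Matrix.of g).det| * ((1 / N : ℝ) ^ N * L ^ d) *
            (Real.exp (L * m) * Real.exp (∑ j, (1 / N : ℝ) * φ (g j))) := by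
          simp only [Clow]; ring
      _ = _ := by rw [← hprod, ← Real.exp_add]; ring
  · set α : Fin N → ℝ := fun j => if j ∈ D then 1 / (N * R) else L * κ / N with hα
    have hαpos : ∀ j, 0 < α j := fun j => by simp only [hα]; split_ifs <;> positivity
    have hfm : Measurable fun y => ENNReal.ofReal (Real.exp (L * φ y)) := by fun_prop
    have hint : ∫⁻ y in P, ENNReal.ofReal (Real.exp (L * φ y)) ≤
        ENNReal.ofReal (|(Matrix.of g).det| * (Real.exp (L * m + 1) * ∏ j, (2 / α j))) := by
      rw [← lintegral_indicator hPm, lintegral_eq_det_mul_lintegral_comp g hdet x₀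
        (hfm.indicator hPm), ENNReal.ofReal_mul (abs_nonneg _),
        ENNReal.ofReal_mul (Real.exp_pos _).le, ← lintegral_exp_neg_sum_mul_abs hαpos]
      refine mul_le_mul_right ?_ _
      rw [← lintegral_const_mul' _ _ ENNReal.ofReal_ne_top]
      refine lintegral_mono fun t => ?_
      by_cases ht : x₀ + ∑ j, t j • g j ∈ P
      swap
      · rw [Set.indicator_of_notMem ht]; exact zero_le
      rw [Set.indicator_of_mem ht, ← ENNReal.ofReal_mul (Real.exp_pos _).le, ← Real.exp_add,
        map_add, hx₀.2]
      refine ENNReal.ofReal_le_ofReal (Real.exp_le_exp.2 ?_)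
      set δ := -φ (∑ j, t j • g j) with hδ
      have hδ0 : 0 ≤ δ := by
        have := hmax _ ht
        rw [map_add] at this
        linarith
      have hLδ : δ ≤ L * δ := le_mul_of_one_le_left hδ0 hL
      have hterm : ∀ j, α j * |t j| ≤ (1 + L * δ) / N := fun j => by
        rw [le_div_iff₀ hNpos]
        by_cases hj : j ∈ D
        · have h1 := hRt t ht j
          simp only [hα, hj, if_true]
          calc 1 / (N * R) * |t j| * N = |t j| / R := by field_simp
            _ ≤ 1 + δ := by rw [div_le_iff₀ hR]; linarith
            _ ≤ 1 + L * δ := by linarith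
        · have h1 := hκt t ht j hj
          simp only [hα, hj, if_false]
          calc L * κ / N * |t j| * N = L * (κ * |t j|) := by field_simp
            _ ≤ L * δ := by gcongr
            _ ≤ 1 + L * δ := by linarith
      have hsum : ∑ j, α j * |t j| ≤ 1 + L * δ := by
        calc ∑ j, α j * |t j| ≤ ∑ _j : Fin N, (1 + L * δ) / N :=
              Finset.sum_le_sum fun j _ => hterm j
          _ = 1 + L * δ := by simp; field_simp
      have : L * (m + φ (∑ j, t j • g j)) = L * m - L * δ := by rw [hδ]; ring
      linarith
    have hprod : L ^ N * ∏ j, (2 / α j) =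
        (∏ j, if j ∈ D then 2 * N * R else 2 * N / κ) * L ^ d := by
      have h2 : L ^ N = ∏ _j : Fin N, L := by simp
      rw [← hLd, h2, ← Finset.prod_mul_distrib, ← Finset.prod_mul_distrib]
      refine Finset.prod_congr rfl fun j _ => ?_
      by_cases hj : j ∈ D
      · simp only [hα, hj, if_true]; field_simp
      · simp only [hα, hj, if_false]; field_simp
    refine (mul_le_mul_right hint _).trans ?_
    rw [← ENNReal.ofReal_mul (by positivity)]
    refine ENNReal.ofReal_le_ofReal ?_
    calc L ^ N * (|(Matrix.of g).det| * (Real.exp (L * m + 1) * ∏ j, (2 / α j)))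
        = |(Matrix.of g).det| * (L ^ N * ∏ j, (2 / α j)) * Real.exp (L * m + 1) := by ring
      _ = Cup * (L ^ d * Real.exp (L * m)) := by
          rw [hprod, Real.exp_add]; simp only [Cup]; ring
      _ ≤ _ := by
          gcongr
          exact (le_max_right _ _).trans (le_max_right _ _)

/-- The inequalities defining `P_{a,s}`. -/
def PsetLinear (N : ℕ) (G : Finset ((Fin N → ℕ) × ℝ)) (a : Fin N → ℕ) :
    Fin N ⊕ G → (Fin N → ℝ) →ₗ[ℝ] ℝ :=
  Sum.elim (fun i => -LinearMap.proj i)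
    fun p => ∑ i, ((a i : ℝ) - (p.1.1 i : ℝ)) • LinearMap.proj i

/-- The right-hand sides of the inequalities defining `P_{a,s}`. -/
def PsetBound (N : ℕ) (G : Finset ((Fin N → ℕ) × ℝ)) (s : ℝ) : Fin N ⊕ G → ℝ :=
  Sum.elim (fun _ => 0) fun p => p.1.2 - s

theorem Pset_eq_setOf_linear (N : ℕ) (G : Finset ((Fin N → ℕ) × ℝ)) (a : Fin N → ℕ) (s : ℝ) :
    Pset N G a s = {y | ∀ i, PsetLinear N G a i y ≤ PsetBound N G s i} := by
  ext y
  simp [Pset, PsetLinear, PsetBound]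

/-- Under assumption (A), for every `(a,s) ∈ 𝔊°` with `a − b − 𝟏 ≠ 0`,
`J_{a,s}(r) ≈ r^{−s−m_{a,s}} (ln(1/r))^{d_{a,s}}` as `r → 0⁺`, where `m_{a,s}` is the maximum
of `φ_a` on `P_{a,s}` and `d_{a,s}` is the affine dimension of
`M_{a,s} = {x ∈ P_{a,s} : φ_a(x) = m_{a,s}}`. -/
theorem stmt12 (N : ℕ) (hN : 1 ≤ N) (G : Finset ((Fin N → ℕ) × ℝ)) (hGne : G.Nonempty)
    (hGs : ∀ p ∈ G, 0 ≤ p.2) (b : Fin N → ℕ)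
    (hA : ∀ r : ℝ, 0 < r → r < 1 → Ifun N G b r < ⊤) :
    ∀ p ∈ Gcirc N G, (∃ i, p.1 i ≠ b i + 1) →
      ∀ m : ℝ, IsGreatest (phiFun N p.1 b '' Pset N G p.1 p.2) m →
      ∃ C : ℝ, 1 ≤ C ∧ ∃ r₀ : ℝ, 0 < r₀ ∧ r₀ < 1 ∧ ∀ r : ℝ, 0 < r → r < r₀ →
        ENNReal.ofReal (C⁻¹ * ((Real.log (1/r)) ^
            (Module.finrank ℝ (affineSpan ℝ
              {x ∈ Pset N G p.1 p.2 | phiFun N p.1 b x = m}).direction) / r ^ (p.2 + m))) ≤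
          Jfun N G b p.1 p.2 r ∧
        Jfun N G b p.1 p.2 r ≤
          ENNReal.ofReal (C * ((Real.log (1/r)) ^
            (Module.finrank ℝ (affineSpan ℝ
              {x ∈ Pset N G p.1 p.2 | phiFun N p.1 b x = m}).direction) / r ^ (p.2 + m))) := by
  intro p hp _ m hm
  obtain ⟨hpG, hvol⟩ := Finset.mem_filter.1 hp
  set φ : (Fin N → ℝ) →ₗ[ℝ] ℝ :=
    ∑ i, ((p.1 i : ℝ) - (b i : ℝ) - 1) • LinearMap.proj i with hφ_def
  have hφ : ∀ y, phiFun N p.1 b y = φ y := fun y => by simp [phiFun, hφ_def]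
  have hPm : MeasurableSet (Pset N G p.1 p.2) := by
    rw [Pset_eq_setOf_linear, Set.ofPred_forall]
    exact MeasurableSet.iInter fun i => (isClosed_le
      (PsetLinear N G p.1 i).continuous_of_finiteDimensional continuous_const).measurableSet
  have hfin := lintegral_Pset_exp_lt_top
    (hA _ (Real.exp_pos _) (Real.exp_lt_one_iff.2 (by norm_num))) hpG hPm
  have hφ' : phiFun N p.1 b = φ := funext hφ
  set d := Module.finrank ℝ (affineSpan ℝ
    {x ∈ Pset N G p.1 p.2 | phiFun N p.1 b x = m}).direction with hd
  simp only [Jfun]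
  rw [hφ'] at hfin hm hd ⊢
  rw [Pset_eq_setOf_linear] at hvol hfin hm hd ⊢
  obtain ⟨C, hC, hbound⟩ := exists_lintegral_exp_polyhedron_bounds hN _ _ φ hvol hfin hm hd
  refine ⟨C, hC, Real.exp (-1), Real.exp_pos _, Real.exp_lt_one_iff.2 (by norm_num),
    fun r hr hr1 => ?_⟩
  set L := Real.log (1 / r) with hL
  have hLr : L = -Real.log r := by rw [hL, one_div, Real.log_inv]
  have hL1 : 1 ≤ L := by
    have := Real.log_lt_log hr hr1
    rw [Real.log_exp] at this
    linarith
  have hrs : 0 < r ^ p.2 := Real.rpow_pos_of_pos hr _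
  have hscale : ∀ A : ℝ, A * (L ^ d / r ^ (p.2 + m)) =
      (r ^ p.2)⁻¹ * (A * (L ^ d * Real.exp (L * m))) := fun A => by
    have h1 : Real.exp (L * m) = (r ^ m)⁻¹ := by
      rw [Real.rpow_def_of_pos hr, ← Real.exp_neg, hLr]
      congr 1
      ring
    rw [h1, Real.rpow_add hr, div_eq_mul_inv, mul_inv]
    ring
  obtain ⟨hlow, hup⟩ := hbound L hL1
  rw [hscale, hscale, div_eq_inv_mul, ENNReal.ofReal_mul (p := (r ^ p.2)⁻¹) (by positivity),
    ENNReal.ofReal_mul (p := (r ^ p.2)⁻¹) (by positivity),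
    ENNReal.ofReal_mul (p := (r ^ p.2)⁻¹) (by positivity), mul_assoc]
  exact ⟨mul_le_mul_right hlow _, mul_le_mul_right hup _⟩
end

section
/- Let w be a positive integer with w ≤ Q − 1 and, for each integer k with w ≤ k ≤ Q, let f_k : ℝⁿ → [0,∞) be continuous with f_k(δ_t(x)) = t^{Q−k} f_k(x) for all t > 0 and x ∈ ℝⁿ; assume f_Q is a positive constant, and assume there is a polynomial function λ̃ : ℝⁿ → ℝ, not identically zero, with λ̃(δ_t(x)) = t^{Q−w} λ̃(x) for all t > 0 and x ∈ ℝⁿ and |λ̃(x)| ≤ f_w(x) for all x. Suppose 𝒜 ⊆ {1,…,n} is such that every f_k depends only on the coordinates x_j with j ∈ 𝒜, and set α(X) = Σ_{j∈𝒜} α_j. Define Λ(x,r) = Σ_{k=w}^{Q} f_k(x) r^k. Let Ω ⊆ ℝⁿ be a bounded open set containing the origin and suppose there exist a real number Q₀ and a real number d₀ ≥ 0 such that ∫_Ω Λ(x,r)⁻¹ dx ≈ r^{−Q₀} (ln(1/r))^{d₀} as r → 0⁺. Then max{w, Q − α(X)} ≤ Q₀ ≤ Q − 1. -/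
open MeasureTheory

open Filter Topology in
/-- Powers dominate powers times powers of logarithms. -/
lemma le_of_rpow_le_rpow_mul_log {a b d K : ℝ}
    (h : ∀ᶠ s : ℝ in atTop, s ^ a ≤ K * (s ^ b * Real.log s ^ d)) : a ≤ b := by
  by_contra! hab
  have h1 := (isLittleO_log_rpow_rpow_atTop d (sub_pos.2 hab)).def
    (show (0 : ℝ) < (2 * (|K| + 1))⁻¹ by positivity)
  obtain ⟨s, hs, hs', hs1⟩ := (h.and (h1.and (eventually_gt_atTop 1))).exists
  have hs0 : 0 < s := by linarith
  have hlog : 0 < Real.log s := Real.log_pos hs1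
  have hL : 0 < Real.log s ^ d := Real.rpow_pos_of_pos hlog _
  have hsb : 0 < s ^ b := Real.rpow_pos_of_pos hs0 _
  have hsa : 0 < s ^ a := Real.rpow_pos_of_pos hs0 _
  have hmul : s ^ b * s ^ (a - b) = s ^ a := by
    rw [← Real.rpow_add hs0]; congr 1; ring
  rw [Real.norm_of_nonneg hL.le, Real.norm_of_nonneg (Real.rpow_pos_of_pos hs0 _).le] at hs'
  have h2 : K * (s ^ b * Real.log s ^ d) ≤ (|K| + 1) * (s ^ b * Real.log s ^ d) := by
    gcongr
    linarith [le_abs_self K]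
  have h3 : (|K| + 1) * (s ^ b * Real.log s ^ d) ≤
      (|K| + 1) * (s ^ b * ((2 * (|K| + 1))⁻¹ * s ^ (a - b))) := by gcongr
  have h4 : (|K| + 1) * (s ^ b * ((2 * (|K| + 1))⁻¹ * s ^ (a - b))) = s ^ a / 2 := by
    rw [← hmul]
    have : |K| + 1 ≠ 0 := by positivity
    field_simp
  linarith

lemma ENNReal.rpow_neg_antitone {β : ℝ} (hβ : 0 ≤ β) {x y : ENNReal} (h : x ≤ y) :
    y ^ (-β) ≤ x ^ (-β) := by
  rw [ENNReal.rpow_neg, ENNReal.rpow_neg]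
  exact ENNReal.inv_le_inv.2 (ENNReal.rpow_le_rpow h hβ)

open Set in
lemma lintegral_Ioo_enorm_rpow_neg_lt_top {β : ℝ} (hβ1 : β < 1) :
    ∫⁻ u in Ioo (-1 : ℝ) 1, ‖u‖ₑ ^ (-β) < ⊤ := by
  have hint : Integrable (fun u : ℝ => (Ioo (0 : ℝ) 1).indicator (fun y => y ^ (-β)) ‖u‖) := by
    rw [integrable_fun_norm_addHaar (μ := (volume : Measure ℝ))]
    simp only [Module.finrank_self, Nat.sub_self, pow_zero, one_smul]
    refine IntegrableOn.integrable_indicator ?_ measurableSet_Ioo |>.integrableOn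
    rw [intervalIntegral.integrableOn_Ioo_rpow_iff one_pos]
    linarith
  refine lt_of_le_of_lt ?_ hint.2
  rw [← lintegral_indicator measurableSet_Ioo]
  refine lintegral_mono_ae ?_
  filter_upwards [Measure.ae_ne volume (0 : ℝ)] with u hu
  by_cases h : u ∈ Ioo (-1 : ℝ) 1
  · have hpos : 0 < ‖u‖ := norm_pos_iff.2 hu
    have h' : ‖u‖ ∈ Ioo (0 : ℝ) 1 := ⟨hpos, by rw [Real.norm_eq_abs, abs_lt]; exact h⟩
    rw [indicator_of_mem h, indicator_of_mem h',
      Real.enorm_of_nonneg (Real.rpow_nonneg hpos.le _), ← ENNReal.ofReal_rpow_of_pos hpos,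
      ofReal_norm]
  · simp [indicator_of_notMem h]

open Set in
lemma exists_lintegral_enorm_sub_rpow_neg_le {β : ℝ} (hβ : 0 ≤ β) (hβ1 : β < 1) :
    ∃ K : ENNReal, K < ⊤ ∧ ∀ a : ℝ, ∫⁻ t in Icc (0 : ℝ) 1, ‖t - a‖ₑ ^ (-β) ≤ K := by
  refine ⟨(∫⁻ u in Ioo (-1 : ℝ) 1, ‖u‖ₑ ^ (-β)) + 1,
    ENNReal.add_lt_top.2 ⟨lintegral_Ioo_enorm_rpow_neg_lt_top hβ1, by simp⟩, fun a => ?_⟩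
  set g : ℝ → ENNReal := (Ioo (-1 : ℝ) 1).indicator fun u => ‖u‖ₑ ^ (-β) with hg
  have hpt : ∀ u : ℝ, ‖u‖ₑ ^ (-β) ≤ g u + 1 := by
    intro u
    by_cases h : u ∈ Ioo (-1 : ℝ) 1
    · rw [hg, indicator_of_mem h]; exact le_self_add
    · have h1 : (1 : ENNReal) ≤ ‖u‖ₑ := by
        have : 1 ≤ |u| := by
          by_contra! hc
          exact h (abs_lt.1 hc)
        rw [Real.enorm_eq_ofReal_abs]
        simpa using ENNReal.ofReal_le_ofReal this
      calc ‖u‖ₑ ^ (-β) ≤ 1 ^ (-β) := ENNReal.rpow_neg_antitone hβ h1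
        _ ≤ g u + 1 := by simp
  calc ∫⁻ t in Icc (0 : ℝ) 1, ‖t - a‖ₑ ^ (-β)
      ≤ ∫⁻ t in Icc (0 : ℝ) 1, (g (t - a) + 1) := lintegral_mono fun t => hpt _
    _ = (∫⁻ t in Icc (0 : ℝ) 1, g (t - a)) + 1 := by
        rw [lintegral_add_right _ measurable_const]; simp
    _ ≤ (∫⁻ t, g (t - a)) + 1 := by gcongr; exact Measure.restrict_le_self
    _ = _ := by rw [lintegral_sub_right_eq_self g a, hg, lintegral_indicator measurableSet_Ioo]

lemma Multiset.exists_mem_pow_card_le_prod (s : Multiset ENNReal) (hs : s ≠ 0) :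
    ∃ a ∈ s, a ^ s.card ≤ s.prod := by
  obtain ⟨a, ha, hmin⟩ := s.exists_min_image id hs
  exact ⟨a, ha, Multiset.pow_card_le_prod hmin⟩

open Polynomial Set in
/-- Negative powers of polynomials of degree `D` with prescribed leading coefficient are uniformly
integrable on the unit interval, as long as the exponent is less than `1 / D`. -/
lemma exists_lintegral_enorm_eval_rpow_neg_le {D : ℕ} (hD : 0 < D) {c : ℝ} (hc : c ≠ 0) {θ : ℝ}
    (hθ : 0 ≤ θ) (hθD : D * θ < 1) :
    ∃ K : ENNReal, K < ⊤ ∧ ∀ p : ℝ[X], p.natDegree = D → p.leadingCoeff = c →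
      ∫⁻ t in Icc (0 : ℝ) 1, ‖p.eval t‖ₑ ^ (-θ) ≤ K := by
  obtain ⟨K, hK, hKb⟩ := exists_lintegral_enorm_sub_rpow_neg_le (β := D * θ) (by positivity) hθD
  refine ⟨‖c‖ₑ ^ (-θ) * (D * K), ?_, fun p hp hpc => ?_⟩
  · refine ENNReal.mul_lt_top ?_ (ENNReal.mul_lt_top (by simp) hK)
    rw [ENNReal.rpow_neg, ENNReal.inv_lt_top]
    exact ENNReal.rpow_pos (by simpa using hc) (by simp)
  set q : ℂ[X] := p.map (algebraMap ℝ ℂ) with hq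
  have hsp := IsAlgClosed.splits q
  have hcard : q.roots.card = D := by
    rw [← hsp.natDegree_eq_card_roots, hq, natDegree_map, hp]
  set s : Multiset ℝ := q.roots.map Complex.re with hs
  have hscard : s.card = D := by rw [hs, Multiset.card_map, hcard]
  have hlow : ∀ t : ℝ, ‖c‖ₑ * (s.map fun a => ‖t - a‖ₑ).prod ≤ ‖p.eval t‖ₑ := by
    intro t
    have h1 : ‖p.eval t‖ₑ = ‖q.eval (t : ℂ)‖ₑ := by
      have : q.eval (t : ℂ) = ((p.eval t : ℝ) : ℂ) := by
        rw [hq, eval_map]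
        exact (Polynomial.hom_eval₂ p (RingHom.id ℝ) (algebraMap ℝ ℂ) t).symm
      rw [this, ← ofReal_norm, ← ofReal_norm, Complex.norm_real]
    have h2 : q.eval (t : ℂ) = (c : ℂ) * (q.roots.map fun z => (t : ℂ) - z).prod := by
      conv_lhs => rw [hsp.eq_prod_roots]
      rw [eval_mul, eval_C, eval_multiset_prod, Multiset.map_map]
      congr 1
      · rw [hq, leadingCoeff_map, hpc]; rfl
      · simp
    have h3 : ‖(q.roots.map fun z => (t : ℂ) - z).prod‖ₑ
        = (q.roots.map fun z => ‖(t : ℂ) - z‖ₑ).prod := by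
      induction q.roots using Multiset.induction_on with
      | empty => simp
      | cons a m ih => simp [enorm_mul, ih]
    rw [h1, h2, enorm_mul, h3, hs, Multiset.map_map]
    refine mul_le_mul' (le_of_eq ?_) (Multiset.prod_map_le_prod_map₀ _ _ (by simp) ?_)
    · rw [← ofReal_norm, ← ofReal_norm, Complex.norm_real]
    · intro z _
      rw [Function.comp_apply, ← ofReal_norm, ← ofReal_norm]
      refine ENNReal.ofReal_le_ofReal ?_
      simpa using Complex.abs_re_le_norm ((t : ℂ) - z)
  have hup : ∀ t : ℝ, ‖p.eval t‖ₑ ^ (-θ) ≤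
      ‖c‖ₑ ^ (-θ) * (s.map fun a => ‖t - a‖ₑ ^ (-(D * θ))).sum := by
    intro t
    obtain ⟨e, he, hepow⟩ := (s.map fun a => ‖t - a‖ₑ).exists_mem_pow_card_le_prod
      (by rw [← Multiset.card_pos, Multiset.card_map, hscard]; exact hD)
    rw [Multiset.card_map, hscard] at hepow
    obtain ⟨a, ha, rfl⟩ := Multiset.mem_map.1 he
    calc ‖p.eval t‖ₑ ^ (-θ) ≤ (‖c‖ₑ * ‖t - a‖ₑ ^ D) ^ (-θ) :=
          ENNReal.rpow_neg_antitone hθ ((mul_le_mul_right hepow _).trans (hlow t))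
      _ = ‖c‖ₑ ^ (-θ) * ‖t - a‖ₑ ^ (-(D * θ)) := by
          rw [ENNReal.mul_rpow_of_ne_top (by simp) (by simp), ← ENNReal.rpow_natCast,
            ← ENNReal.rpow_mul, mul_neg]
      _ ≤ _ := by
          gcongr
          exact Multiset.single_le_sum (by simp) _ (Multiset.mem_map_of_mem _ ha)
  have hmeas : ∀ a : ℝ, Measurable fun t : ℝ => ‖t - a‖ₑ ^ (-(D * θ)) := fun a => by fun_prop
  have hsum : ∀ m : Multiset ℝ, Measurable (fun t : ℝ => (m.map fun a => ‖t - a‖ₑ ^ (-(D * θ))).sum)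
      ∧ ∫⁻ t in Icc (0 : ℝ) 1, (m.map fun a => ‖t - a‖ₑ ^ (-(D * θ))).sum ≤ m.card * K := by
    intro m
    induction m using Multiset.induction_on with
    | empty => simp
    | cons a m ih =>
      simp only [Multiset.map_cons, Multiset.sum_cons, Multiset.card_cons]
      refine ⟨(hmeas a).add ih.1, ?_⟩
      rw [lintegral_add_left (hmeas a)]
      push_cast
      rw [add_mul, one_mul, add_comm]
      exact add_le_add ih.2 (hKb a)
  calc ∫⁻ t in Icc (0 : ℝ) 1, ‖p.eval t‖ₑ ^ (-θ)
      ≤ ∫⁻ t in Icc (0 : ℝ) 1, ‖c‖ₑ ^ (-θ) * (s.map fun a => ‖t - a‖ₑ ^ (-(D * θ))).sum :=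
        lintegral_mono hup
    _ = ‖c‖ₑ ^ (-θ) * ∫⁻ t in Icc (0 : ℝ) 1, (s.map fun a => ‖t - a‖ₑ ^ (-(D * θ))).sum :=
        lintegral_const_mul _ (hsum s).1
    _ ≤ ‖c‖ₑ ^ (-θ) * (D * K) := by
        gcongr
        simpa only [hscard] using (hsum s).2

open Filter Topology Polynomial in
/-- Along an anisotropic curve, a homogeneous polynomial of degree `D` restricts to a polynomial of
degree `D` whose leading coefficient does not depend on the base point. -/
lemma exists_polynomial_eval_add_dilation {n : ℕ} {α : Fin n → ℕ} (hα : ∀ i, 0 < α i) {D : ℕ}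
    (lam : MvPolynomial (Fin n) ℝ)
    (hom : ∀ t : ℝ, 0 < t → ∀ x : Fin n → ℝ,
      MvPolynomial.eval (fun i => t ^ α i * x i) lam = t ^ D * MvPolynomial.eval x lam)
    {v : Fin n → ℝ} (hv : MvPolynomial.eval v lam ≠ 0) (x : Fin n → ℝ) :
    ∃ p : ℝ[X], p.natDegree = D ∧ p.leadingCoeff = MvPolynomial.eval v lam ∧
      ∀ t, p.eval t = MvPolynomial.eval (x + fun i => t ^ α i * v i) lam := by
  set p : ℝ[X] := MvPolynomial.aeval (fun i => C (x i) + X ^ α i * C (v i)) lam with hp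
  have heval : ∀ t, p.eval t = MvPolynomial.eval (x + fun i => t ^ α i * v i) lam := by
    intro t
    have := MvPolynomial.eval₂_comp_left (Polynomial.evalRingHom t) (algebraMap ℝ ℝ[X])
      (fun i => C (x i) + X ^ α i * C (v i)) lam
    rw [hp, MvPolynomial.aeval_def, ← Polynomial.coe_evalRingHom, this,
      MvPolynomial.eval, MvPolynomial.coe_eval₂Hom]
    congr 1
    · ext r; simp
    · ext i; simpa using mul_comm _ _
  have hlim : Tendsto (fun t => p.eval t / (X ^ D : ℝ[X]).eval t) atTop
      (𝓝 (MvPolynomial.eval v lam)) := by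
    have hcont : Continuous fun y : Fin n → ℝ => MvPolynomial.eval y lam :=
      MvPolynomial.continuous_eval lam
    have h0 : Tendsto (fun t : ℝ => fun i => v i + (t ^ α i)⁻¹ * x i) atTop (𝓝 v) := by
      rw [tendsto_pi_nhds]
      intro i
      have := (tendsto_pow_atTop (α := ℝ) (hα i).ne').inv_tendsto_atTop
      simpa using (this.mul_const (x i)).const_add (v i)
    refine ((hcont.tendsto v).comp h0).congr' ?_
    filter_upwards [eventually_gt_atTop 0] with t ht
    have : (x + fun i => t ^ α i * v i) = fun i => t ^ α i * (v i + (t ^ α i)⁻¹ * x i) := by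
      ext i
      have : t ^ α i ≠ 0 := by positivity
      simp only [Pi.add_apply]
      field_simp
      ring
    rw [heval, this, hom t ht, eval_pow, eval_X, mul_div_cancel_left₀ _ (by positivity)]
    rfl
  have hX : (X ^ D : ℝ[X]) ≠ 0 := pow_ne_zero _ X_ne_zero
  have hdeg : p.degree = (X ^ D : ℝ[X]).degree := by
    rcases lt_trichotomy p.degree (X ^ D : ℝ[X]).degree with h | h | h
    · exact absurd (tendsto_nhds_unique hlim
        ((div_tendsto_atTop_zero_iff_degree_lt p _ hX).2 h)) hv
    · exact h
    · exact absurd hlim.abs (not_tendsto_nhds_of_tendsto_atTop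
        (abs_div_tendsto_atTop_atTop_of_degree_gt p _ h hX) _)
  refine ⟨p, ?_, ?_, heval⟩
  · rw [natDegree_eq_of_degree_eq hdeg, natDegree_X_pow]
  · have := tendsto_nhds_unique hlim (div_tendsto_atTop_leadingCoeff_div_of_degree_eq p _ hdeg)
    rw [this, (monic_X_pow D).leadingCoeff, div_one]

open Set in
/-- A homogeneous polynomial of degree `D` has locally integrable powers of exponents greater than
`-1 / D`. -/
lemma lintegral_enorm_mvPolynomial_eval_rpow_neg_lt_top {n : ℕ} {α : Fin n → ℕ}
    (hα : ∀ i, 0 < α i) {D : ℕ} (hD : 0 < D) (lam : MvPolynomial (Fin n) ℝ)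
    (hom : ∀ t : ℝ, 0 < t → ∀ x : Fin n → ℝ,
      MvPolynomial.eval (fun i => t ^ α i * x i) lam = t ^ D * MvPolynomial.eval x lam)
    (hne : ∃ x : Fin n → ℝ, MvPolynomial.eval x lam ≠ 0) {θ : ℝ} (hθ : 0 ≤ θ) (hθD : D * θ < 1)
    {Ω : Set (Fin n → ℝ)} (hΩm : MeasurableSet Ω) (hΩ : Bornology.IsBounded Ω) :
    ∫⁻ x in Ω, ‖MvPolynomial.eval x lam‖ₑ ^ (-θ) < ⊤ := by
  obtain ⟨v, hv⟩ := hne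
  obtain ⟨K, hK, hKb⟩ := exists_lintegral_enorm_eval_rpow_neg_le hD hv hθ hθD
  obtain ⟨R, hR⟩ := hΩ.subset_closedBall 0
  set δ : ℝ → Fin n → ℝ := fun t i => t ^ α i * v i with hδ
  have hδm : Measurable δ := measurable_pi_lambda _ fun i => by fun_prop
  have hδle : ∀ t ∈ Icc (0 : ℝ) 1, ‖δ t‖ ≤ ‖v‖ := by
    intro t ht
    refine (pi_norm_le_iff_of_nonneg (norm_nonneg _)).2 fun i => ?_
    rw [hδ, norm_mul, norm_pow, Real.norm_of_nonneg ht.1]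
    calc t ^ α i * ‖v i‖ ≤ 1 * ‖v‖ :=
          mul_le_mul (pow_le_one₀ ht.1 ht.2) (norm_le_pi_norm v i) (norm_nonneg _) zero_le_one
      _ = ‖v‖ := one_mul _
  set g : (Fin n → ℝ) → ENNReal := fun x => ‖MvPolynomial.eval x lam‖ₑ ^ (-θ) with hg
  have hgm : Measurable g := by
    have : Measurable fun x : Fin n → ℝ => MvPolynomial.eval x lam :=
      (MvPolynomial.continuous_eval lam).measurable
    fun_prop
  set B : Set (Fin n → ℝ) := Metric.closedBall 0 (R + ‖v‖) with hB
  have hgΩ : Measurable (Ω.indicator g) := hgm.indicator hΩm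
  have hpt : ∀ t ∈ Icc (0 : ℝ) 1, ∀ x, Ω.indicator g (x + δ t) ≤ B.indicator 1 x * g (x + δ t) := by
    intro t ht x
    by_cases hx : x + δ t ∈ Ω
    · have hxB : x ∈ B := by
        have h1 := mem_closedBall_zero_iff.1 (hR hx)
        rw [hB, mem_closedBall_zero_iff]
        calc ‖x‖ = ‖x + δ t - δ t‖ := by rw [add_sub_cancel_right]
          _ ≤ ‖x + δ t‖ + ‖δ t‖ := norm_sub_le _ _
          _ ≤ R + ‖v‖ := add_le_add h1 (hδle t ht)
      simp [indicator_of_mem hx, indicator_of_mem hxB]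
    · simp [indicator_of_notMem hx]
  calc ∫⁻ x in Ω, g x = ∫⁻ x, Ω.indicator g x := (lintegral_indicator hΩm g).symm
    _ = ∫⁻ _ in Icc (0 : ℝ) 1, ∫⁻ x, Ω.indicator g x := by simp
    _ = ∫⁻ t in Icc (0 : ℝ) 1, ∫⁻ x, Ω.indicator g (x + δ t) := by
        simp_rw [lintegral_add_right_eq_self (Ω.indicator g)]
    _ = ∫⁻ x, ∫⁻ t in Icc (0 : ℝ) 1, Ω.indicator g (x + δ t) := by
        refine lintegral_lintegral_swap (Measurable.aemeasurable ?_)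
        exact hgΩ.comp (measurable_snd.add (hδm.comp measurable_fst))
    _ ≤ ∫⁻ x, B.indicator 1 x * K := by
        refine lintegral_mono fun x => ?_
        obtain ⟨p, hpD, hpc, hpe⟩ := exists_polynomial_eval_add_dilation hα lam hom hv x
        calc ∫⁻ t in Icc (0 : ℝ) 1, Ω.indicator g (x + δ t)
            ≤ ∫⁻ t in Icc (0 : ℝ) 1, B.indicator 1 x * g (x + δ t) :=
              setLIntegral_mono' measurableSet_Icc fun t ht => hpt t ht x
          _ = B.indicator 1 x * ∫⁻ t in Icc (0 : ℝ) 1, ‖p.eval t‖ₑ ^ (-θ) := by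
              rw [lintegral_const_mul (f := fun t => g (x + δ t)) _
                (hgm.comp (hδm.const_add x))]
              simp_rw [hg, hpe, hδ]
          _ ≤ _ := by gcongr; exact hKb p hpD hpc
    _ = volume B * K := by
        rw [lintegral_mul_const _ (measurable_one.indicator measurableSet_closedBall),
          lintegral_indicator_one measurableSet_closedBall]
    _ < ⊤ := ENNReal.mul_lt_top measure_closedBall_lt_top hK

open Filter in
lemma le_of_forall_rpow_neg_le {a b d K r₀ : ℝ} (hr₀ : 0 < r₀)
    (h : ∀ r : ℝ, 0 < r → r < r₀ → r ^ (-a) ≤ K * (r ^ (-b) * Real.log (1 / r) ^ d)) :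
    a ≤ b := by
  refine le_of_rpow_le_rpow_mul_log (K := K) (d := d) ?_
  filter_upwards [eventually_gt_atTop 0, eventually_gt_atTop r₀⁻¹] with s hs hs'
  have := h s⁻¹ (inv_pos.2 hs) (inv_lt_of_inv_lt₀ hr₀ hs')
  rwa [Real.inv_rpow hs.le, Real.inv_rpow hs.le, Real.rpow_neg hs.le, Real.rpow_neg hs.le,
    inv_inv, inv_inv, one_div, inv_inv] at this

lemma exists_forall_le_on_ball {ι E : Type*} [NormedAddCommGroup E] [ProperSpace E]
    (s : Finset ι) (f : ι → E → ℝ) (hf : ∀ k ∈ s, Continuous (f k)) (R : ℝ) :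
    ∃ M : ℝ, 0 < M ∧ ∀ k ∈ s, ∀ x ∈ Metric.closedBall (0 : E) R, f k x ≤ M := by
  have h : ∀ k ∈ s, ∃ M : ℝ, ∀ x ∈ Metric.closedBall (0 : E) R, f k x ≤ M := by
    intro k hk
    obtain ⟨M, hM⟩ := (isCompact_closedBall (0 : E) R).bddAbove_image (hf k hk).continuousOn
    exact ⟨M, fun x hx => hM ⟨x, hx, rfl⟩⟩
  choose! M hM using h
  refine ⟨1 + ∑ k ∈ s, |M k|, by positivity, fun k hk x hx => (hM k hk x hx).trans ?_⟩
  have := Finset.single_le_sum (f := fun k => |M k|) (fun _ _ => abs_nonneg _) hk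
  linarith [le_abs_self (M k)]

lemma mul_le_setIntegral_inv {X : Type*} [MeasurableSpace X] {μ : Measure X} {S Ω : Set X}
    {g : X → ℝ} (hS : MeasurableSet S) (hSΩ : S ⊆ Ω) (hμ : μ S ≠ ⊤)
    (hg : ∀ x, 0 < g x) (hint : IntegrableOn (fun x => (g x)⁻¹) Ω μ) {c : ℝ}
    (hc : ∀ x ∈ S, g x ≤ c) : c⁻¹ * μ.real S ≤ ∫ x in Ω, (g x)⁻¹ ∂μ :=
  (setIntegral_ge_of_const_le_real hS hμ
    (fun x hx => inv_anti₀ (hg x) (hc x hx)) (hint.mono_set hSΩ)).trans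
    (setIntegral_mono_set hint (.of_forall fun x => (inv_pos.2 (hg x)).le)
      (.of_forall hSΩ))

/-- With `Λ(x,r) = Σ_{k=w}^{Q} f_k(x) r^k` (each `f_k ≥ 0` continuous and
`δ_t`-homogeneous of degree `Q−k`, `f_Q` a positive constant, `w ≤ Q−1`), suppose there is a
nonzero polynomial `λ̃` homogeneous of degree `Q−w` with `|λ̃| ≤ f_w`, the `f_k` depend only
on coordinates in `𝒜` (with `α(X) = Σ_{j∈𝒜} α_j`), and
`∫_Ω Λ(x,r)⁻¹ dx ≈ r^{−Q₀} (ln(1/r))^{d₀}` as `r → 0⁺` over a bounded open `Ω ∋ 0`.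
Then `max{w, Q − α(X)} ≤ Q₀ ≤ Q − 1`. -/
theorem stmt15 (n : ℕ) (α : Fin n → ℕ) (hα : ∀ i, 0 < α i)
    (w : ℕ) (hw : 0 < w) (hwQ : w + 1 ≤ ∑ i, α i)
    (f : ℕ → (Fin n → ℝ) → ℝ)
    (hf_cont : ∀ k ∈ Finset.Icc w (∑ i, α i), Continuous (f k))
    (hf_nonneg : ∀ k ∈ Finset.Icc w (∑ i, α i), ∀ x, 0 ≤ f k x)
    (hf_hom : ∀ k ∈ Finset.Icc w (∑ i, α i), ∀ t : ℝ, 0 < t → ∀ x : Fin n → ℝ,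
      f k (fun i => t ^ α i * x i) = t ^ ((∑ i, α i) - k) * f k x)
    (hfQ : ∃ cQ : ℝ, 0 < cQ ∧ ∀ x, f (∑ i, α i) x = cQ)
    (lam : MvPolynomial (Fin n) ℝ)
    (hlam_ne : ∃ x : Fin n → ℝ, MvPolynomial.eval x lam ≠ 0)
    (hlam_hom : ∀ t : ℝ, 0 < t → ∀ x : Fin n → ℝ,
      MvPolynomial.eval (fun i => t ^ α i * x i) lam =
        t ^ ((∑ i, α i) - w) * MvPolynomial.eval x lam)
    (hlam_le : ∀ x : Fin n → ℝ, |MvPolynomial.eval x lam| ≤ f w x)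
    (A : Finset (Fin n))
    (hdep : ∀ k ∈ Finset.Icc w (∑ i, α i), ∀ x y : Fin n → ℝ,
      (∀ j ∈ A, x j = y j) → f k x = f k y)
    (Ω : Set (Fin n → ℝ)) (hΩo : IsOpen Ω) (hΩb : Bornology.IsBounded Ω)
    (hΩ0 : (0 : Fin n → ℝ) ∈ Ω)
    (Q₀ d₀ : ℝ) (hd₀ : 0 ≤ d₀)
    (hasymp : ∃ C : ℝ, 1 ≤ C ∧ ∃ r₀ : ℝ, 0 < r₀ ∧ r₀ < 1 ∧ ∀ r : ℝ, 0 < r → r < r₀ →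
      C⁻¹ * (r ^ (-Q₀) * Real.log (1/r) ^ d₀) ≤
        (∫ x in Ω, (∑ k ∈ Finset.Icc w (∑ i, α i), f k x * r ^ k)⁻¹) ∧
      (∫ x in Ω, (∑ k ∈ Finset.Icc w (∑ i, α i), f k x * r ^ k)⁻¹) ≤
        C * (r ^ (-Q₀) * Real.log (1/r) ^ d₀)) :
    (w : ℝ) ≤ Q₀ ∧ ((∑ i, α i : ℕ) : ℝ) - ((∑ j ∈ A, α j : ℕ) : ℝ) ≤ Q₀ ∧
      Q₀ ≤ ((∑ i, α i : ℕ) : ℝ) - 1 := by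
  obtain ⟨C, hC, r₀, hr₀, hr₀1, hasymp⟩ := hasymp
  obtain ⟨c, hc, hfc⟩ := hfQ
  set Q : ℕ := ∑ i, α i with hQ
  set I : Finset ℕ := Finset.Icc w Q with hI
  set Λ : ℝ → (Fin n → ℝ) → ℝ := fun r x => ∑ k ∈ I, f k x * r ^ k with hΛ
  have hC0 : 0 < C := by linarith
  have hwI : w ∈ I := Finset.mem_Icc.2 ⟨le_rfl, by omega⟩
  have hQI : Q ∈ I := Finset.mem_Icc.2 ⟨by omega, le_rfl⟩
  have hterm : ∀ r, 0 < r → ∀ x, ∀ k ∈ I, 0 ≤ f k x * r ^ k := fun r hr x k hk =>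
    mul_nonneg (hf_nonneg k hk x) (by positivity)
  have hΛQ : ∀ r, 0 < r → ∀ x, c * r ^ Q ≤ Λ r x := fun r hr x => by
    simpa only [hfc] using
      Finset.single_le_sum (f := fun k => f k x * r ^ k) (hterm r hr x) hQI
  have hΛw : ∀ r, 0 < r → ∀ x, |MvPolynomial.eval x lam| * r ^ w ≤ Λ r x := fun r hr x =>
    (mul_le_mul_of_nonneg_right (hlam_le x) (by positivity)).trans
      (Finset.single_le_sum (f := fun k => f k x * r ^ k) (hterm r hr x) hwI)
  have hΛpos : ∀ r, 0 < r → ∀ x, 0 < Λ r x := fun r hr x =>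
    lt_of_lt_of_le (by positivity) (hΛQ r hr x)
  have hΛcont : ∀ r, Continuous (Λ r) := fun r =>
    continuous_finsetSum _ fun k hk => (hf_cont k hk).mul continuous_const
  have hinvcont : ∀ r, 0 < r → Continuous fun x => (Λ r x)⁻¹ := fun r hr =>
    (hΛcont r).inv₀ fun x => (hΛpos r hr x).ne'
  have hint : ∀ r, 0 < r → IntegrableOn (fun x => (Λ r x)⁻¹) Ω := fun r hr => by
    refine Measure.integrableOn_of_bounded (M := (c * r ^ Q)⁻¹) hΩb.measure_lt_top.ne
      (hinvcont r hr).aestronglyMeasurable (.of_forall fun x => ?_)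
    rw [Real.norm_of_nonneg (inv_nonneg.2 (hΛpos r hr x).le)]
    exact inv_anti₀ (by positivity) (hΛQ r hr x)
  have hIcard : 0 < (I.card : ℝ) := by exact_mod_cast Finset.card_pos.2 ⟨w, hwI⟩
  refine ⟨?_, ?_, ?_⟩
  · obtain ⟨R, hR⟩ := hΩb.subset_closedBall 0
    obtain ⟨M, hM, hfM⟩ := exists_forall_le_on_ball I f hf_cont R
    have hvol : 0 < volume.real Ω :=
      ENNReal.toReal_pos (hΩo.measure_pos volume ⟨0, hΩ0⟩).ne' hΩb.measure_lt_top.ne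
    refine le_of_forall_rpow_neg_le (d := d₀) (K := C * (I.card * M) / volume.real Ω) hr₀
      fun r hr hrr => ?_
    have hle : ∀ x ∈ Ω, Λ r x ≤ I.card * M * r ^ w := fun x hx => by
      calc Λ r x ≤ ∑ k ∈ I, M * r ^ w := by
            refine Finset.sum_le_sum fun k hk => ?_
            exact mul_le_mul (hfM k hk x (hR hx))
              (pow_le_pow_of_le_one hr.le (by linarith) (Finset.mem_Icc.1 hk).1)
              (by positivity) hM.le
        _ = I.card * M * r ^ w := by rw [Finset.sum_const, nsmul_eq_mul, mul_assoc]
    have h := (mul_le_setIntegral_inv hΩo.measurableSet subset_rfl hΩb.measure_lt_top.ne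
      (hΛpos r hr) (hint r hr) hle).trans (hasymp r hr hrr).2
    rw [Real.rpow_neg hr.le (w : ℝ), Real.rpow_natCast, div_mul_eq_mul_div, le_div_iff₀ hvol]
    calc (r ^ w)⁻¹ * volume.real Ω
        = I.card * M * ((I.card * M * r ^ w)⁻¹ * volume.real Ω) := by field_simp
      _ ≤ I.card * M * (C * (r ^ (-Q₀) * Real.log (1 / r) ^ d₀)) := by gcongr
      _ = _ := by ring
  · obtain ⟨η', hη', hball⟩ := Metric.isOpen_iff.1 hΩo 0 hΩ0
    obtain ⟨M, hM, hfM⟩ := exists_forall_le_on_ball I f hf_cont 1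
    set η : ℝ := min (η' / 2) 1 with hη
    have hη0 : 0 < η := lt_min (by linarith) one_pos
    have hη1 : η ≤ 1 := min_le_right _ _
    set q : ℕ := ∑ j ∈ A, α j with hq
    refine le_of_forall_rpow_neg_le (d := d₀) (K := C * (I.card * M) / η ^ n) hr₀
      fun r hr hrr => ?_
    set b : Fin n → ℝ := fun j => η * if j ∈ A then r ^ α j else 1 with hb
    have hb0 : ∀ j, 0 ≤ b j := fun j => by
      simp only [hb]; split_ifs <;> positivity
    have hbη : ∀ j, b j ≤ η := fun j => by
      refine mul_le_of_le_one_right hη0.le ?_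
      split_ifs
      · exact pow_le_one₀ hr.le (by linarith)
      · exact le_rfl
    have hSΩ : Set.Icc 0 b ⊆ Ω := by
      refine fun x hx => hball (mem_ball_zero_iff.2 ?_)
      refine lt_of_le_of_lt ((pi_norm_le_iff_of_nonneg hη0.le).2 fun j => ?_)
        (lt_of_le_of_lt (min_le_left _ _) (half_lt_self hη'))
      rw [Real.norm_of_nonneg (hx.1 j)]
      exact (hx.2 j).trans (hbη j)
    have hvol : volume.real (Set.Icc 0 b) = η ^ n * r ^ q := by
      rw [Measure.real, Real.volume_Icc_pi, ENNReal.toReal_prod]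
      simp only [Pi.zero_apply, sub_zero, ENNReal.toReal_ofReal (hb0 _)]
      rw [hb, Finset.prod_mul_distrib, Finset.prod_const, Finset.card_univ, Fintype.card_fin,
        Finset.prod_ite_mem, Finset.univ_inter, Finset.prod_pow_eq_pow_sum]
    have hle : ∀ x ∈ Set.Icc 0 b, Λ r x ≤ I.card * M * r ^ Q := fun x hx => by
      set y : Fin n → ℝ := fun j => if j ∈ A then (r ^ α j)⁻¹ * x j else 0 with hy
      have hy1 : y ∈ Metric.closedBall 0 1 := by
        rw [mem_closedBall_zero_iff, pi_norm_le_iff_of_nonneg zero_le_one]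
        intro j
        by_cases hj : j ∈ A
        · have hx2 := hx.2 j
          have hx1 : 0 ≤ x j := hx.1 j
          simp only [hb, hj, if_true] at hx2
          simp only [hy, hj, if_true]
          rw [Real.norm_of_nonneg (by positivity), inv_mul_le_iff₀ (by positivity), mul_one]
          exact hx2.trans (mul_le_of_le_one_left (by positivity) hη1)
        · simp [hy, hj]
      have hfy : ∀ k ∈ I, f k x = r ^ (Q - k) * f k y := fun k hk => by
        rw [← hf_hom k hk r hr y]
        refine hdep k hk _ _ fun j hj => ?_
        simp only [hy, hj, if_true]
        rw [mul_inv_cancel_left₀ (by positivity)]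
      calc Λ r x ≤ ∑ k ∈ I, M * r ^ Q := by
            refine Finset.sum_le_sum fun k hk => ?_
            rw [hfy k hk, mul_right_comm, ← pow_add, Nat.sub_add_cancel (Finset.mem_Icc.1 hk).2,
              mul_comm]
            gcongr
            exact hfM k hk y hy1
        _ = I.card * M * r ^ Q := by rw [Finset.sum_const, nsmul_eq_mul, mul_assoc]
    have h := (mul_le_setIntegral_inv measurableSet_Icc hSΩ
      (measure_ne_top_of_subset hSΩ hΩb.measure_lt_top.ne)
      (hΛpos r hr) (hint r hr) hle).trans (hasymp r hr hrr).2
    rw [hvol] at h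
    rw [neg_sub, Real.rpow_sub hr, Real.rpow_natCast, Real.rpow_natCast, div_mul_eq_mul_div,
      le_div_iff₀ (by positivity)]
    calc r ^ q / r ^ Q * η ^ n
        = I.card * M * ((I.card * M * r ^ Q)⁻¹ * (η ^ n * r ^ q)) := by field_simp
      _ ≤ I.card * M * (C * (r ^ (-Q₀) * Real.log (1 / r) ^ d₀)) := by gcongr
      _ = _ := by ring
  · have hD : 0 < Q - w := by omega
    have hDR : (0 : ℝ) < (Q - w : ℕ) := by exact_mod_cast hD
    have hDcast : ((Q - w : ℕ) : ℝ) = Q - w := by push_cast [show w ≤ Q by omega]; ring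
    have key : ∀ τ : ℝ, 0 < τ → τ < 1 → Q₀ ≤ Q - τ := by
      intro τ hτ hτ1
      set θ : ℝ := τ / (Q - w : ℕ) with hθ
      have hθ0 : 0 < θ := by positivity
      have hDθ : ((Q - w : ℕ) : ℝ) * θ = τ := by rw [hθ]; field_simp
      have hθ1 : θ < 1 := by
        have : (1 : ℝ) ≤ (Q - w : ℕ) := by exact_mod_cast hD
        nlinarith
      have hKfin := lintegral_enorm_mvPolynomial_eval_rpow_neg_lt_top hα hD lam hlam_hom hlam_ne
        hθ0.le (by rw [hDθ]; exact hτ1) hΩo.measurableSet hΩb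
      set K : ENNReal := ∫⁻ x in Ω, ‖MvPolynomial.eval x lam‖ₑ ^ (-θ)
      refine le_of_forall_rpow_neg_le (d := 0) (K := C * (c ^ (θ - 1) * K.toReal))
        (lt_min hr₀ (Real.exp_pos (-1))) fun r hr hrr => ?_
      have hlog : 1 ≤ Real.log (1 / r) := by
        rw [one_div, Real.log_inv, le_neg, Real.log_le_iff_le_exp hr]
        exact (hrr.trans_le (min_le_right _ _)).le
      have hΛlow : ∀ x, |MvPolynomial.eval x lam| ^ θ * (c ^ (1 - θ) * r ^ (Q - τ)) ≤ Λ r x := by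
        intro x
        calc |MvPolynomial.eval x lam| ^ θ * (c ^ (1 - θ) * r ^ (Q - τ))
            = (|MvPolynomial.eval x lam| * r ^ w) ^ θ * (c * r ^ Q) ^ (1 - θ) := by
              rw [Real.mul_rpow (abs_nonneg _) (by positivity),
                Real.mul_rpow hc.le (by positivity), ← Real.rpow_natCast, ← Real.rpow_natCast,
                ← Real.rpow_mul hr.le, ← Real.rpow_mul hr.le,
                show (Q : ℝ) - τ = w * θ + Q * (1 - θ) by rw [← hDθ, hDcast]; ring,
                Real.rpow_add hr]
              ring
          _ ≤ Λ r x ^ θ * Λ r x ^ (1 - θ) := by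
              gcongr
              · exact Real.rpow_nonneg (hΛpos r hr x).le _
              · exact hΛw r hr x
              · exact hΛQ r hr x
          _ = Λ r x := by
              rw [← Real.rpow_add (hΛpos r hr x), add_sub_cancel, Real.rpow_one]
      set E : ℝ := c ^ (θ - 1) * r ^ (-(Q - τ)) with hE
      have hE0 : 0 < E := by positivity
      have hpt : ∀ x, ENNReal.ofReal (Λ r x)⁻¹ ≤
          ENNReal.ofReal E * ‖MvPolynomial.eval x lam‖ₑ ^ (-θ) := by
        intro x
        by_cases hx : MvPolynomial.eval x lam = 0
        · rw [hx, enorm_zero, ENNReal.zero_rpow_of_neg (by linarith),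
            ENNReal.mul_top (by simpa using hE0)]
          exact le_top
        · have hx' : 0 < |MvPolynomial.eval x lam| := abs_pos.2 hx
          rw [Real.enorm_eq_ofReal_abs, ENNReal.ofReal_rpow_of_pos hx',
            ← ENNReal.ofReal_mul hE0.le]
          refine ENNReal.ofReal_le_ofReal ((inv_anti₀ (by positivity) (hΛlow x)).trans_eq ?_)
          rw [mul_inv, mul_inv, ← Real.rpow_neg hx'.le, ← Real.rpow_neg hc.le,
            ← Real.rpow_neg hr.le, hE, neg_sub 1 θ, mul_comm]
      have hupper : ∫ x in Ω, (Λ r x)⁻¹ ≤ E * K.toReal := by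
        rw [integral_eq_lintegral_of_nonneg_ae
          (.of_forall fun x => (inv_pos.2 (hΛpos r hr x)).le)
          (hinvcont r hr).aestronglyMeasurable]
        rw [← ENNReal.toReal_ofReal hE0.le, ← ENNReal.toReal_mul]
        refine ENNReal.toReal_mono (ENNReal.mul_ne_top (by simp) hKfin.ne) ?_
        rw [← lintegral_const_mul' _ _ (by simp)]
        exact lintegral_mono hpt
      have h := (hasymp r hr (hrr.trans_le (min_le_left _ _))).1.trans hupper
      rw [inv_mul_le_iff₀ hC0] at h
      rw [Real.rpow_zero, mul_one]
      calc r ^ (-Q₀) ≤ r ^ (-Q₀) * Real.log (1 / r) ^ d₀ :=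
            le_mul_of_one_le_right (by positivity) (Real.one_le_rpow hlog hd₀)
        _ ≤ C * (E * K.toReal) := h
        _ = _ := by rw [hE]; ring
    by_contra! hcon
    obtain ⟨τ, h1, h2⟩ := exists_between (show max 0 ((Q : ℝ) - Q₀) < 1 by
      rw [max_lt_iff]; constructor <;> linarith)
    have := key τ (lt_of_le_of_lt (le_max_left _ _) h1) h2
    linarith [lt_of_le_of_lt (le_max_right _ _) h1]
end
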